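/- arXiv:1710.02727 — 2 statements merged into one kernel-verified Lean document; each statement's English description precedes it below -/
import Mathlib

section
/- Let H be a finite graph and let 𝒢 be a class of finite graphs closed under taking subgraphs such that every graph in 𝒢 is H-minor-free. Then for every integer t ≥ 1 the following are equivalent: (i) there exists ε > 0 such that every graph G ∈ 𝒢 contains at least ε·|V(G)| pairwise disjoint t-islands; (ii) there exists ε > 0 such that every non-null graph in 𝒢 is ε-resistant to t-percolation. In other words, pcol_⋆(𝒢) = p(𝒢). -/
open SimpleGraph

/-- `S` is a `t`-island in `G`: a nonempty set of vertices each of which has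
fewer than `t` neighbors outside `S`. -/
def IsIsland {V : Type*} (G : SimpleGraph V) (t : ℕ) (S : Set V) : Prop :=
  S.Nonempty ∧ ∀ v ∈ S, ((G.neighborSet v) \ S).ncard < t

/-- `H` is a minor of `G`: there is a model of `H` in `G`. -/
def IsMinorOf {W V : Type*} (H : SimpleGraph W) (G : SimpleGraph V) : Prop :=
  ∃ μ : W → Set V,
    (∀ w, (μ w).Nonempty) ∧
    (∀ w, (G.induce (μ w)).Connected) ∧
    (Pairwise fun w₁ w₂ => Disjoint (μ w₁) (μ w₂)) ∧
    (∀ ⦃w₁ w₂⦄, H.Adj w₁ w₂ → ∃ u ∈ μ w₁, ∃ v ∈ μ w₂, G.Adj u v)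

/-- The graph `I_n + P_m`: a path on `m` vertices together with `n` additional
pairwise non-adjacent vertices, each adjacent to every vertex of the path. -/
def IplusP (n m : ℕ) : SimpleGraph (Fin n ⊕ Fin m) :=
  SimpleGraph.fromRel (fun a b =>
    (∃ i j, a = Sum.inl i ∧ b = Sum.inr j) ∨
    (∃ i j : Fin m, a = Sum.inr i ∧ b = Sum.inr j ∧ (i : ℕ) + 1 = (j : ℕ)))

/-- `c` is a coloring of `G` with clustering `C`: every monochromatic connected
subgraph has at most `C` vertices. -/
def ClusteredColoring {V α : Type*} (G : SimpleGraph V) (C : ℕ) (c : V → α) : Prop :=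
  ∀ S : Set V, (G.induce S).Connected → (∀ u ∈ S, ∀ v ∈ S, c u = c v) → S.ncard ≤ C

/-- `G` has a tree decomposition of width at most `w`. -/
def HasTreewidthAtMost {V : Type*} (G : SimpleGraph V) (w : ℕ) : Prop :=
  ∃ (n : ℕ) (T : SimpleGraph (Fin n)) (β : Fin n → Set V), T.IsTree ∧
    (∀ ⦃u v⦄, G.Adj u v → ∃ x, u ∈ β x ∧ v ∈ β x) ∧
    (∀ v : V, (T.induce {x | v ∈ β x}).Connected) ∧
    (∀ x, (β x).ncard ≤ w + 1)

/-- A class of graphs, given for each `n` as a collection of graphs on `Fin n`. -/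
def MemClass (𝒢 : ∀ n : ℕ, SimpleGraph (Fin n) → Prop) {V : Type*} (G : SimpleGraph V) : Prop :=
  ∃ (n : ℕ) (G' : SimpleGraph (Fin n)), 𝒢 n G' ∧ Nonempty (G ≃g G')

/-- `𝒢` is a (proper) minor-closed class. -/
def MinorClosed (𝒢 : ∀ n : ℕ, SimpleGraph (Fin n) → Prop) : Prop :=
  (∃ (n : ℕ) (G : SimpleGraph (Fin n)), ¬ 𝒢 n G) ∧
  ∀ ⦃n k : ℕ⦄ (G : SimpleGraph (Fin n)) (H : SimpleGraph (Fin k)),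
    𝒢 n G → IsMinorOf H G → 𝒢 k H

/-- `𝒢` is closed under taking subgraphs (up to isomorphism). -/
def SubgraphClosed (𝒢 : ∀ n : ℕ, SimpleGraph (Fin n) → Prop) : Prop :=
  ∀ ⦃n k : ℕ⦄ (G : SimpleGraph (Fin n)) (H : SimpleGraph (Fin k)), 𝒢 n G →
    (∃ f : Fin k → Fin n, Function.Injective f ∧ ∀ ⦃a b⦄, H.Adj a b → G.Adj (f a) (f b)) →
    𝒢 k H

/-- The vertices that eventually become active in bootstrap `t`-percolation
starting from the active set `A`. -/
inductive PercolationActive {V : Type*} (G : SimpleGraph V) (t : ℕ) (A : Set V) : V → Prop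
  | base (v : V) : v ∈ A → PercolationActive G t A v
  | step (v : V) (N : Finset V) : t ≤ N.card → (∀ u ∈ N, G.Adj v u) →
      (∀ u ∈ N, PercolationActive G t A u) → PercolationActive G t A v

/-- The set `A` `t`-percolates in `G`. -/
def Percolates {V : Type*} (G : SimpleGraph V) (t : ℕ) (A : Set V) : Prop :=
  ∀ v, PercolationActive G t A v

/-- `G` contains `k` pairwise disjoint `t`-islands. -/
def HasDisjointIslands {V : Type*} (G : SimpleGraph V) (t k : ℕ) : Prop :=
  ∃ f : Fin k → Set V, (∀ i, IsIsland G t (f i)) ∧ Pairwise (Function.onFun Disjoint f)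

/-- `f` is significantly sublinear: `∑ f(⌈(3/2)^i⌉)/(3/2)^i` is finite. -/
def SignificantlySublinear (f : ℕ → ℕ) : Prop :=
  Summable (fun i : ℕ => (f ⌈((3:ℝ)/2)^i⌉₊ : ℝ) / ((3:ℝ)/2)^i)

/-- The class `𝒢` has `f`-separators. -/
def HasSeparators (f : ℕ → ℕ) (𝒢 : ∀ n : ℕ, SimpleGraph (Fin n) → Prop) : Prop :=
  ∀ (n : ℕ) (G : SimpleGraph (Fin n)), 𝒢 n G →
    ∃ L R : G.Subgraph, L ⊔ R = ⊤ ∧ (L.verts ∩ R.verts).ncard ≤ f n ∧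
      3 * (L.verts \ R.verts).ncard ≤ 2 * n ∧ 3 * (R.verts \ L.verts).ncard ≤ 2 * n

/-- The number of edges of `G` with at least one end in `A`. -/
noncomputable def edgesTouching {V : Type*} (G : SimpleGraph V) (A : Set V) : ℕ :=
  {e ∈ G.edgeSet | ∃ v ∈ A, v ∈ e}.ncard

namespace Percolation

variable {V : Type*} [DecidableEq V]

open Classical in
/-- The vertices of `U` outside `S` that have a neighbor in `S`. -/
noncomputable def nb (G : SimpleGraph V) (U S : Finset V) : Finset V :=
  {v ∈ U | v ∉ S ∧ ∃ s ∈ S, G.Adj s v}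

theorem mem_nb {G : SimpleGraph V} {U S : Finset V} {v : V} :
    v ∈ nb G U S ↔ v ∈ U ∧ v ∉ S ∧ ∃ s ∈ S, G.Adj s v := by
  simp [nb]

/-- The ball of radius `i` around `u` in the subgraph induced by `U`. -/
noncomputable def ball (G : SimpleGraph V) (U : Finset V) (u : V) : ℕ → Finset V
  | 0 => {u}
  | i + 1 => ball G U u i ∪ nb G U (ball G U u i)

theorem ball_subset {G : SimpleGraph V} {U : Finset V} {u : V} (hu : u ∈ U) (i : ℕ) :
    ball G U u i ⊆ U := by
  induction i with
  | zero => simpa [ball] using hu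
  | succ i ih =>
    exact Finset.union_subset ih fun v hv => (mem_nb.1 hv).1

theorem self_mem_ball (G : SimpleGraph V) (U : Finset V) (u : V) (i : ℕ) :
    u ∈ ball G U u i := by
  induction i with
  | zero => simp [ball]
  | succ i ih => exact Finset.mem_union_left _ ih

theorem card_ball_succ (G : SimpleGraph V) (U : Finset V) (u : V) (i : ℕ) :
    (ball G U u (i + 1)).card = (ball G U u i).card + (nb G U (ball G U u i)).card :=
  Finset.card_union_of_disjoint
    (Finset.disjoint_left.2 fun _ hv hv' => (mem_nb.1 hv').2.1 hv)

theorem exists_connected_of_mem_ball {G : SimpleGraph V} {U : Finset V} {u : V} (hu : u ∈ U)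
    {i : ℕ} {v : V} (hv : v ∈ ball G U u i) :
    ∃ P ⊆ U, u ∈ P ∧ v ∈ P ∧ P.card ≤ i + 1 ∧ (G.induce (P : Set V)).Connected := by
  induction i generalizing v with
  | zero =>
    obtain rfl : v = u := by simpa [ball] using hv
    refine ⟨{v}, by simpa using hu, by simp, by simp, by simp, ?_⟩
    rw [SimpleGraph.connected_iff_exists_forall_reachable]
    refine ⟨⟨v, by simp⟩, ?_⟩
    rintro ⟨w, hw⟩
    obtain rfl : w = v := by simpa using hw
    exact Reachable.refl _
  | succ i ih =>
    rcases Finset.mem_union.1 hv with hv | hv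
    · obtain ⟨P, h1, h2, h3, h4, h5⟩ := ih hv
      exact ⟨P, h1, h2, h3, by omega, h5⟩
    · obtain ⟨hvU, -, s, hs, hsv⟩ := mem_nb.1 hv
      obtain ⟨P, h1, h2, h3, h4, h5⟩ := ih hs
      refine ⟨insert v P, Finset.insert_subset hvU h1, by simp [h2], by simp,
        (Finset.card_insert_le _ _).trans (by omega), ?_⟩
      have := SimpleGraph.induce_union_connected h5.preconnected
        (induce_pair_connected_of_adj hsv).preconnected ⟨s, h3, by simp⟩
      have e : ((insert v P : Finset V) : Set V) = (P : Set V) ∪ {s, v} := by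
        ext w
        simp only [Finset.coe_insert, Set.mem_insert_iff, Finset.mem_coe, Set.mem_union,
          Set.mem_singleton_iff]
        constructor
        · rintro (h | h) <;> simp [h]
        · rintro (h | rfl | h)
          · simp [h]
          · exact Or.inr h3
          · simp [h]
      rw [e]
      exact this

theorem two_mul_pow_self_le (q : ℕ) (hq : 0 < q) : 2 * q ^ q ≤ (q + 1) ^ q := by
  have key : ∀ n : ℕ, q ^ n * (q + n) ≤ (q + 1) ^ n * q := by
    intro n
    induction n with
    | zero => simp
    | succ n ih =>
      calc q ^ (n + 1) * (q + (n + 1)) = q ^ n * (q * (q + n) + q) := by ring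
        _ ≤ q ^ n * (q * (q + n) + (q + n)) := by gcongr; omega
        _ = (q + 1) * (q ^ n * (q + n)) := by ring
        _ ≤ (q + 1) * ((q + 1) ^ n * q) := by gcongr
        _ = (q + 1) ^ (n + 1) * q := by ring
  have := key q
  refine Nat.le_of_mul_le_mul_right (c := q) ?_ hq
  calc 2 * q ^ q * q = q ^ q * (q + q) := by ring
    _ ≤ _ := this

/-- In a set with vertex expansion `1 / q`, balls of radius `q * (L + 1)` are large. -/
theorem card_ball_large {G : SimpleGraph V} {U : Finset V} {d m q L : ℕ} (hq : 0 < q)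
    (hm : m < 2 ^ (L + 1))
    (hexp : ∀ S ⊆ U, S.Nonempty → 2 * (S.card + d) ≤ m → S.card < q * (nb G U S).card)
    {u : V} (hu : u ∈ U) : m < 2 * ((ball G U u (q * (L + 1))).card + d) := by
  have grow : ∀ i, (q + 1) ^ i ≤ (ball G U u i).card * q ^ i ∨
      m < 2 * ((ball G U u i).card + d) := by
    intro i
    induction i with
    | zero => left; simp [ball]
    | succ i ih =>
      have hc := card_ball_succ G U u i
      by_cases h : 2 * ((ball G U u i).card + d) ≤ m
      · left
        have h1 := hexp _ (ball_subset hu i) ⟨u, self_mem_ball G U u i⟩ h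
        have h2 := ih.resolve_right (by omega)
        calc (q + 1) ^ (i + 1) = (q + 1) * (q + 1) ^ i := by ring
          _ ≤ (q + 1) * ((ball G U u i).card * q ^ i) := by gcongr
          _ = (q * (ball G U u i).card + (ball G U u i).card) * q ^ i := by ring
          _ ≤ (q * (ball G U u i).card + q * (nb G U (ball G U u i)).card) * q ^ i := by
              gcongr
          _ = (ball G U u (i + 1)).card * q ^ (i + 1) := by rw [hc]; ring
      · right; omega
  rcases grow (q * (L + 1)) with h | h
  · have h1 : 2 ^ (L + 1) * q ^ (q * (L + 1)) ≤ (q + 1) ^ (q * (L + 1)) := by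
      rw [pow_mul, pow_mul, ← mul_pow]
      exact Nat.pow_le_pow_left (two_mul_pow_self_le q hq) _
    have h2 := Nat.le_of_mul_le_mul_right (h1.trans h) (by positivity)
    omega
  · exact h

theorem card_ball_gt_half {G : SimpleGraph V} {U : Finset V} {d m q L : ℕ} (hq : 0 < q)
    (hm : m < 2 ^ (L + 1)) (hbig : 2 * q * (d + 1) + 2 * d + 2 ≤ m)
    (hexp : ∀ S ⊆ U, S.Nonempty → 2 * (S.card + d) ≤ m → S.card < q * (nb G U S).card)
    {u : V} (hu : u ∈ U) : m < 2 * (ball G U u (q * (L + 1) + 1)).card := by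
  have h := card_ball_large hq hm hexp hu
  obtain ⟨S, hS, hSc⟩ := Finset.exists_subset_card_eq
    (s := ball G U u (q * (L + 1))) (n := m / 2 - d) (by omega)
  have hqd : q * (d + 1) ≤ S.card := by
    have : 2 * q * (d + 1) = 2 * (q * (d + 1)) := by ring
    omega
  have hSpos : 0 < S.card := lt_of_lt_of_le (by positivity) hqd
  have h1 := hexp S (hS.trans (ball_subset hu _)) (Finset.card_pos.1 hSpos) (by omega)
  have h2 : d + 1 < (nb G U S).card := Nat.lt_of_mul_lt_mul_left (hqd.trans_lt h1)
  have h3 : S ∪ nb G U S ⊆ ball G U u (q * (L + 1) + 1) := by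
    refine Finset.union_subset (hS.trans Finset.subset_union_left) fun v hv => ?_
    obtain ⟨hvU, -, s, hs, hsv⟩ := mem_nb.1 hv
    by_cases hvb : v ∈ ball G U u (q * (L + 1))
    · exact Finset.mem_union_left _ hvb
    · exact Finset.mem_union_right _ (mem_nb.2 ⟨hvU, hvb, s, hS hs, hsv⟩)
  have h4 := Finset.card_le_card h3
  rw [Finset.card_union_of_disjoint
    (Finset.disjoint_left.2 fun _ hv hv' => (mem_nb.1 hv').2.1 hv)] at h4
  omega

/-- Two vertices of a set with vertex expansion `1 / q` lie in a small connected subset. -/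
theorem exists_small_connected {G : SimpleGraph V} {U : Finset V} {d m q L : ℕ} (hq : 0 < q)
    (hm : m < 2 ^ (L + 1)) (hbig : 2 * q * (d + 1) + 2 * d + 2 ≤ m) (hU : U.card ≤ m)
    (hexp : ∀ S ⊆ U, S.Nonempty → 2 * (S.card + d) ≤ m → S.card < q * (nb G U S).card)
    {u v : V} (hu : u ∈ U) (hv : v ∈ U) :
    ∃ P ⊆ U, u ∈ P ∧ v ∈ P ∧ P.card ≤ 2 * (q * (L + 1)) + 4 ∧
      (G.induce (P : Set V)).Connected := by
  have h1 := card_ball_gt_half hq hm hbig hexp hu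
  have h2 := card_ball_gt_half hq hm hbig hexp hv
  obtain ⟨w, hw⟩ : (ball G U u (q * (L + 1) + 1) ∩ ball G U v (q * (L + 1) + 1)).Nonempty := by
    rw [Finset.nonempty_iff_ne_empty, ne_eq, ← Finset.disjoint_iff_inter_eq_empty]
    intro hd
    have h3 := Finset.card_le_card
      (Finset.union_subset (ball_subset (G := G) hu (q * (L + 1) + 1))
        (ball_subset (G := G) hv (q * (L + 1) + 1)))
    rw [Finset.card_union_of_disjoint hd] at h3
    omega
  rw [Finset.mem_inter] at hw
  obtain ⟨P, a1, a2, a3, a4, a5⟩ := exists_connected_of_mem_ball hu hw.1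
  obtain ⟨Q, b1, b2, b3, b4, b5⟩ := exists_connected_of_mem_ball hv hw.2
  refine ⟨P ∪ Q, Finset.union_subset a1 b1, by simp [a2], by simp [b2],
    (Finset.card_union_le _ _).trans (by omega), ?_⟩
  rw [Finset.coe_union]
  exact SimpleGraph.induce_union_connected a5.preconnected b5.preconnected ⟨w, a3, b3⟩

/-- A model in `Y` of a complete graph, with branch sets of size at most `B`. -/
structure CliqueModel (G : SimpleGraph V) (Y : Finset V) (B : ℕ) (F : Finset (Finset V)) :
    Prop where
  subset : ∀ T ∈ F, T ⊆ Y
  card_le : ∀ T ∈ F, T.card ≤ B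
  connected : ∀ T ∈ F, (G.induce (T : Set V)).Connected
  disjoint : ∀ T ∈ F, ∀ T' ∈ F, T ≠ T' → Disjoint T T'
  adj : ∀ T ∈ F, ∀ T' ∈ F, T ≠ T' → ∃ u ∈ T, ∃ v ∈ T', G.Adj u v

theorem nonempty_of_connected {V : Type*} {G : SimpleGraph V} {T : Finset V}
    (h : (G.induce (T : Set V)).Connected) : T.Nonempty := by
  obtain ⟨⟨v, hv⟩⟩ := h.nonempty
  exact ⟨v, hv⟩

theorem CliqueModel.isMinorOf {V : Type*} {W : Type} [Fintype W] (H : SimpleGraph W)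
    {G : SimpleGraph V} {Y : Finset V} {B : ℕ} {F : Finset (Finset V)} (hF : CliqueModel G Y B F)
    (hcard : F.card = Fintype.card W) : IsMinorOf H G := by
  obtain ⟨e⟩ : Nonempty (W ≃ F) := by
    rw [← Fintype.card_eq, Fintype.card_coe, hcard]
  have hne : ∀ {w₁ w₂ : W}, w₁ ≠ w₂ → (e w₁ : Finset V) ≠ e w₂ := fun h h' =>
    h (e.injective (Subtype.ext h'))
  refine ⟨fun w => ((e w : Finset V) : Set V), fun w => ?_, fun w => hF.connected _ (e w).2,
    fun w₁ w₂ h => ?_, fun w₁ w₂ h => ?_⟩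
  · exact nonempty_of_connected (hF.connected _ (e w).2)
  · exact Finset.disjoint_coe.2 (hF.disjoint _ (e w₁).2 _ (e w₂).2 (hne h))
  · exact hF.adj _ (e w₁).2 _ (e w₂).2 (hne h.ne)

theorem CliqueModel.mono {V : Type*} {G : SimpleGraph V} {Y : Finset V} {B : ℕ}
    {F F' : Finset (Finset V)} (hF : CliqueModel G Y B F) (h : F' ⊆ F) : CliqueModel G Y B F' :=
  ⟨fun T hT => hF.subset T (h hT), fun T hT => hF.card_le T (h hT),
    fun T hT => hF.connected T (h hT), fun T hT T' hT' => hF.disjoint T (h hT) T' (h hT'),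
    fun T hT T' hT' => hF.adj T (h hT) T' (h hT')⟩

theorem CliqueModel.insert {G : SimpleGraph V} {Y : Finset V} {B : ℕ} {F : Finset (Finset V)}
    (hF : CliqueModel G Y B F) {P : Finset V} (hPY : P ⊆ Y) (hPB : P.card ≤ B)
    (hP : (G.induce (P : Set V)).Connected) (hdisj : ∀ T ∈ F, Disjoint T P)
    (hadj : ∀ T ∈ F, ∃ u ∈ T, ∃ v ∈ P, G.Adj u v) :
    CliqueModel G Y B (insert P F) := by
  refine ⟨?_, ?_, ?_, ?_, ?_⟩
  · exact (Finset.forall_mem_insert _ _ _).2 ⟨hPY, hF.subset⟩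
  · exact (Finset.forall_mem_insert _ _ _).2 ⟨hPB, hF.card_le⟩
  · exact (Finset.forall_mem_insert _ _ _).2 ⟨hP, hF.connected⟩
  · intro T hT T' hT' hne
    rcases Finset.mem_insert.1 hT with rfl | hTF
    · exact (hdisj T' ((Finset.mem_insert.1 hT').resolve_left hne.symm)).symm
    · rcases Finset.mem_insert.1 hT' with rfl | hT'
      · exact hdisj T hTF
      · exact hF.disjoint T hTF T' hT' hne
  · intro T hT T' hT' hne
    rcases Finset.mem_insert.1 hT with rfl | hTF
    · obtain ⟨u, hu, v, hv, huv⟩ :=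
        hadj T' ((Finset.mem_insert.1 hT').resolve_left hne.symm)
      exact ⟨v, hv, u, hu, huv.symm⟩
    · rcases Finset.mem_insert.1 hT' with rfl | hT'
      · exact hadj T hTF
      · exact hF.adj T hTF T' hT' hne

/-- A clique model together with a disjoint set `D` of vertices that has few neighbors
outside of the model. -/
structure PrunedModel (G : SimpleGraph V) (Y : Finset V) (B h q : ℕ) (F : Finset (Finset V))
    (D : Finset V) : Prop where
  model : CliqueModel G Y B F
  card_le : F.card ≤ h
  subset : D ⊆ Y
  disjoint : ∀ T ∈ F, Disjoint T D
  two_card_le : 2 * D.card ≤ Y.card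
  nb_le : q * (nb G (Y \ F.biUnion id) D).card ≤ D.card

section Pruned

variable {G : SimpleGraph V} {Y : Finset V} {B h l : ℕ} {F : Finset (Finset V)} {D : Finset V}

theorem PrunedModel.card_biUnion_le {q : ℕ} (hM : PrunedModel G Y B h q F D) :
    (F.biUnion id).card ≤ h * B :=
  (Finset.card_biUnion_le_card_mul F id B hM.model.card_le).trans
    (Nat.mul_le_mul_right _ hM.card_le)

theorem PrunedModel.card_pruned_le (hM : PrunedModel G Y B h (2 * l) F D)
    (hexp : ∀ S ⊆ Y, S.Nonempty → 2 * S.card ≤ Y.card → S.card < l * (nb G Y S).card) :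
    D.card ≤ 2 * l * (h * B) := by
  rcases D.eq_empty_or_nonempty with rfl | hD
  · simp
  have h1 := hexp D hM.subset hD hM.two_card_le
  have h2 : (nb G Y D).card ≤ (nb G (Y \ F.biUnion id) D).card + (F.biUnion id).card := by
    refine (Finset.card_le_card fun v hv => ?_).trans (Finset.card_union_le _ _)
    obtain ⟨a, b⟩ := mem_nb.1 hv
    by_cases hvF : v ∈ F.biUnion id
    · exact Finset.mem_union_right _ hvF
    · exact Finset.mem_union_left _ (mem_nb.2 ⟨Finset.mem_sdiff.2 ⟨a, hvF⟩, b⟩)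
  have h3 := hM.nb_le
  have h4 := hM.card_biUnion_le
  nlinarith [Nat.mul_le_mul_left l h2, Nat.mul_le_mul_left l h4]

/-- A part of the remaining graph with few neighbors can be pruned as well. -/
theorem PrunedModel.union {q : ℕ} (hM : PrunedModel G Y B h q F D) {S : Finset V}
    (hS : S ⊆ (Y \ F.biUnion id) \ D) (hcard : 2 * (S.card + D.card) ≤ Y.card)
    (hnb : q * (nb G ((Y \ F.biUnion id) \ D) S).card ≤ S.card) :
    PrunedModel G Y B h q F (D ∪ S) := by
  have hdisj : Disjoint D S := Finset.disjoint_left.2 fun v hv hv' =>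
    (Finset.mem_sdiff.1 (hS hv')).2 hv
  refine ⟨hM.model, hM.card_le, ?_, ?_, ?_, ?_⟩
  · exact Finset.union_subset hM.subset
      (hS.trans (Finset.sdiff_subset.trans Finset.sdiff_subset))
  · intro T hT
    refine Finset.disjoint_union_right.2 ⟨hM.disjoint T hT, ?_⟩
    refine Finset.disjoint_left.2 fun v hv hv' => ?_
    exact (Finset.mem_sdiff.1 (Finset.mem_sdiff.1 (hS hv')).1).2
      (Finset.mem_biUnion.2 ⟨T, hT, hv⟩)
  · rw [Finset.card_union_of_disjoint hdisj]; omega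
  · rw [Finset.card_union_of_disjoint hdisj]
    have : (nb G (Y \ F.biUnion id) (D ∪ S)).card ≤
        (nb G (Y \ F.biUnion id) D).card + (nb G ((Y \ F.biUnion id) \ D) S).card := by
      refine (Finset.card_le_card fun v hv => ?_).trans (Finset.card_union_le _ _)
      obtain ⟨a, b, s, hs, hsv⟩ := mem_nb.1 hv
      rw [Finset.mem_union, not_or] at b
      rcases Finset.mem_union.1 hs with hs | hs
      · exact Finset.mem_union_left _ (mem_nb.2 ⟨a, b.1, s, hs, hsv⟩)
      · exact Finset.mem_union_right _
          (mem_nb.2 ⟨Finset.mem_sdiff.2 ⟨a, b.1⟩, b.2, s, hs, hsv⟩)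
    have h3 := hM.nb_le
    nlinarith [Nat.mul_le_mul_left q this]

/-- A branch set without neighbors in the remaining graph can be pruned. -/
theorem PrunedModel.erase {q : ℕ} (hM : PrunedModel G Y B h q F D) {T : Finset V} (hT : T ∈ F)
    (hcard : 2 * (T.card + D.card) ≤ Y.card)
    (hnb : ∀ u ∈ T, ∀ v ∈ (Y \ F.biUnion id) \ D, ¬ G.Adj u v) :
    PrunedModel G Y B h q (F.erase T) (D ∪ T) := by
  have hdisj : Disjoint D T := (hM.disjoint T hT).symm
  refine ⟨hM.model.mono (Finset.erase_subset _ _),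
    (Finset.card_le_card (Finset.erase_subset _ _)).trans hM.card_le,
    Finset.union_subset hM.subset (hM.model.subset T hT), ?_, ?_, ?_⟩
  · intro T' hT'
    obtain ⟨hne, hT'⟩ := Finset.mem_erase.1 hT'
    exact Finset.disjoint_union_right.2 ⟨hM.disjoint T' hT', hM.model.disjoint T' hT' T hT hne⟩
  · rw [Finset.card_union_of_disjoint hdisj]; omega
  · refine (Nat.mul_le_mul_left q (Finset.card_le_card fun v hv => ?_)).trans
      (hM.nb_le.trans (Finset.card_le_card Finset.subset_union_left))
    obtain ⟨a, b, s, hs, hsv⟩ := mem_nb.1 hv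
    rw [Finset.mem_union, not_or] at b
    rw [Finset.mem_sdiff] at a
    have hv' : v ∈ Y \ F.biUnion id := by
      refine Finset.mem_sdiff.2 ⟨a.1, fun hvF => a.2 ?_⟩
      obtain ⟨T', hT', hvT'⟩ := Finset.mem_biUnion.1 hvF
      refine Finset.mem_biUnion.2 ⟨T', Finset.mem_erase.2 ⟨?_, hT'⟩, hvT'⟩
      rintro rfl
      exact b.2 hvT'
    rcases Finset.mem_union.1 hs with hs | hs
    · exact mem_nb.2 ⟨hv', b.1, s, hs, hsv⟩
    · exact absurd hsv (hnb s hs v (Finset.mem_sdiff.2 ⟨hv', b.1⟩))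

/-- A pruned model can be extended by a connected set touching all its branch sets. -/
theorem PrunedModel.insert {q : ℕ} (hM : PrunedModel G Y B h q F D) (hh : F.card < h)
    {P : Finset V} (hPU : P ⊆ (Y \ F.biUnion id) \ D) (hPB : P.card ≤ B)
    (hP : (G.induce (P : Set V)).Connected)
    (hadj : ∀ T ∈ F, ∃ u ∈ T, ∃ v ∈ P, G.Adj u v) :
    PrunedModel G Y B h q (insert P F) D := by
  have hPF : ∀ T ∈ F, Disjoint T P := fun T hT => Finset.disjoint_left.2 fun v hv hv' =>
    (Finset.mem_sdiff.1 (Finset.mem_sdiff.1 (hPU hv')).1).2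
      (Finset.mem_biUnion.2 ⟨T, hT, hv⟩)
  refine ⟨hM.model.insert (hPU.trans (Finset.sdiff_subset.trans Finset.sdiff_subset)) hPB hP hPF
    hadj, (Finset.card_insert_le _ _).trans hh, hM.subset, ?_, hM.two_card_le, ?_⟩
  · refine (Finset.forall_mem_insert _ _ _).2 ⟨?_, hM.disjoint⟩
    exact Finset.disjoint_left.2 fun v hv hv' => (Finset.mem_sdiff.1 (hPU hv)).2 hv'
  · refine (Nat.mul_le_mul_left q (Finset.card_le_card fun v hv => ?_)).trans hM.nb_le
    obtain ⟨a, b⟩ := mem_nb.1 hv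
    refine mem_nb.2 ⟨Finset.sdiff_subset_sdiff subset_rfl ?_ a, b⟩
    exact Finset.biUnion_subset_biUnion_of_subset_left _ (Finset.subset_insert _ _)

/-- Finitely many vertices, each joined to a root inside `U`, lie in a connected subset
of `U`. -/
theorem exists_connected_hub {ι : Type*} [DecidableEq ι] {U : Finset V} {c : ℕ} {u₀ : V}
    (hu₀ : u₀ ∈ U) (I : Finset ι) (g : ι → V)
    (hg : ∀ i ∈ I, ∃ P ⊆ U, u₀ ∈ P ∧ g i ∈ P ∧ P.card ≤ c ∧ (G.induce (P : Set V)).Connected) :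
    ∃ P ⊆ U, u₀ ∈ P ∧ (∀ i ∈ I, g i ∈ P) ∧ P.card ≤ 1 + I.card * c ∧
      (G.induce (P : Set V)).Connected := by
  induction I using Finset.induction_on with
  | empty =>
    obtain ⟨P, h1, h2, -, h4, h5⟩ :=
      exists_connected_of_mem_ball (G := G) hu₀ (self_mem_ball G U u₀ 0)
    exact ⟨P, h1, h2, by simp, by simpa using h4, h5⟩
  | insert i I hi ih =>
    obtain ⟨P, h1, h2, h3, h4, h5⟩ := ih fun j hj => hg j (Finset.mem_insert_of_mem hj)
    obtain ⟨Q, k1, k2, k3, k4, k5⟩ := hg i (Finset.mem_insert_self _ _)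
    refine ⟨P ∪ Q, Finset.union_subset h1 k1, by simp [h2], ?_, ?_, ?_⟩
    · refine (Finset.forall_mem_insert _ _ _).2 ⟨by simp [k3], fun j hj => ?_⟩
      exact Finset.mem_union_left _ (h3 j hj)
    · rw [Finset.card_insert_of_notMem hi]
      refine (Finset.card_union_le _ _).trans ?_
      rw [add_mul]
      omega
    · rw [Finset.coe_union]
      exact SimpleGraph.induce_union_connected h5.preconnected k5.preconnected ⟨u₀, h2, k2⟩

end Pruned

/-- A large set without clique models of size `h` with small branch sets has a sparse cut. -/
theorem exists_sparse_cut [Fintype V] {G : SimpleGraph V} {Y : Finset V} {B h l L d : ℕ}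
    (hl : 0 < l) (hB : 1 + h * (2 * (2 * l * (L + 1)) + 4) ≤ B) (hd : 2 * l * (h * B) ≤ d)
    (hY : Y.card < 2 ^ (L + 1)) (hbig : 4 * l * (d + 1) + 2 * d + 2 * B + h * B + 2 ≤ Y.card)
    (hno : ∀ F, CliqueModel G Y B F → F.card ≠ h) :
    ∃ S ⊆ Y, S.Nonempty ∧ 2 * S.card ≤ Y.card ∧ l * (nb G Y S).card ≤ S.card := by
  classical
  by_contra hcon
  have hexp : ∀ S ⊆ Y, S.Nonempty → 2 * S.card ≤ Y.card → S.card < l * (nb G Y S).card := by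
    intro S h1 h2 h3
    by_contra h4
    exact hcon ⟨S, h1, h2, h3, not_lt.1 h4⟩
  obtain ⟨⟨F, D⟩, hM, hmax⟩ := Finset.exists_max_image
    (Finset.univ.filter fun p : Finset (Finset V) × Finset V =>
      PrunedModel G Y B h (2 * l) p.1 p.2) (fun p => p.2.card * (h + 1) + p.1.card)
    ⟨(∅, ∅), by
      refine Finset.mem_filter.2 ⟨Finset.mem_univ _, ⟨by simp, by simp, by simp, by simp,
        by simp⟩, by simp, by simp, by simp, by simp, ?_⟩
      simp [nb]⟩
  have hM : PrunedModel G Y B h (2 * l) F D := (Finset.mem_filter.1 hM).2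
  have hmax : ∀ F' D', PrunedModel G Y B h (2 * l) F' D' →
      D'.card * (h + 1) + F'.card ≤ D.card * (h + 1) + F.card := fun F' D' h' =>
    hmax (F', D') (Finset.mem_filter.2 ⟨Finset.mem_univ _, h'⟩)
  have hFh : F.card < h := lt_of_le_of_ne hM.card_le (hno F hM.model)
  have hDd : D.card ≤ d := (hM.card_pruned_le hexp).trans hd
  have hX := hM.card_biUnion_le
  set U := (Y \ F.biUnion id) \ D with hU
  have hUY : U.card ≤ Y.card :=
    Finset.card_le_card (Finset.sdiff_subset.trans Finset.sdiff_subset)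
  have hUexp : ∀ S ⊆ U, S.Nonempty → 2 * (S.card + d) ≤ Y.card →
      S.card < 2 * l * (nb G U S).card := by
    intro S hS hSne hSc
    by_contra hlt
    have h1 := hmax _ _ (hM.union hS (by omega) (not_lt.1 hlt))
    have hdisj : Disjoint D S := Finset.disjoint_left.2 fun v hv hv' =>
      (Finset.mem_sdiff.1 (hS hv')).2 hv
    rw [Finset.card_union_of_disjoint hdisj] at h1
    have := Finset.card_pos.2 hSne
    nlinarith
  have htouch : ∀ T ∈ F, ∃ v, v ∈ U ∧ ∃ u ∈ T, G.Adj u v := by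
    intro T hT
    by_contra hnot
    push Not at hnot
    have hTB := hM.model.card_le T hT
    have h1 := hmax _ _ (hM.erase hT (by omega) fun u hu v hv => hnot v hv u hu)
    rw [Finset.card_union_of_disjoint (hM.disjoint T hT).symm, Finset.card_erase_of_mem hT] at h1
    have := Finset.card_pos.2 (nonempty_of_connected (hM.model.connected T hT))
    have : (D.card + 1) * (h + 1) ≤ (D.card + T.card) * (h + 1) :=
      Nat.mul_le_mul_right _ (by omega)
    rw [add_mul] at this
    omega
  obtain ⟨u₀, hu₀⟩ : U.Nonempty := by
    rw [← Finset.card_pos]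
    have h1 : _ ≤ U.card := Finset.le_card_sdiff D (Y \ F.biUnion id)
    have h2 := Finset.le_card_sdiff (F.biUnion id) Y
    omega
  have hall : ∀ T : Finset V, ∃ v, T ∈ F → v ∈ U ∧ ∃ u ∈ T, G.Adj u v := by
    intro T
    by_cases hT : T ∈ F
    · obtain ⟨v, hv⟩ := htouch T hT
      exact ⟨v, fun _ => hv⟩
    · exact ⟨u₀, fun h => absurd h hT⟩
  choose g hg using hall
  obtain ⟨P, hPU, hu₀P, hgP, hPc, hPconn⟩ := exists_connected_hub (G := G) hu₀ F g
    (c := 2 * (2 * l * (L + 1)) + 4) fun T hT =>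
      exists_small_connected (q := 2 * l) (L := L) (by omega) hY (by nlinarith) hUY hUexp hu₀
        (hg T hT).1
  have hPB : P.card ≤ B := by
    refine hPc.trans (le_trans ?_ hB)
    gcongr
  have hM' := hM.insert hFh hPU hPB hPconn fun T hT => by
    obtain ⟨-, u, hu, huv⟩ := hg T hT
    exact ⟨u, hu, g T, hgP T hT, huv⟩
  have hPF : P ∉ F := fun hPF =>
    (Finset.mem_sdiff.1 (Finset.mem_sdiff.1 (hPU hu₀P)).1).2
      (Finset.mem_biUnion.2 ⟨P, hPF, hu₀P⟩)
  have := hmax _ _ hM'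
  rw [Finset.card_insert_of_notMem hPF] at this
  omega

theorem eventually_mul_pow_le_two_pow (c k : ℕ) : ∃ N, ∀ n ≥ N, c * n ^ k ≤ 2 ^ n := by
  have h := tendsto_pow_const_div_const_pow_of_one_lt k (r := 2) one_lt_two
  have hc : (0 : ℝ) < 1 / (c + 1) := by positivity
  obtain ⟨N, hN⟩ := Filter.eventually_atTop.1 (h.eventually (gt_mem_nhds hc))
  refine ⟨N, fun n hn => ?_⟩
  have h1 := hN n hn
  rw [div_lt_div_iff₀ (by positivity) (by positivity)] at h1
  have h2 : ((c * n ^ k : ℕ) : ℝ) ≤ ((2 ^ n : ℕ) : ℝ) := by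
    push_cast
    have : (0 : ℝ) ≤ (n : ℝ) ^ k := by positivity
    nlinarith
  exact_mod_cast h2

/-- The parameters of `exists_sparse_cut` are eventually small compared to `2 ^ L`. -/
theorem eventually_parameters_le (h : ℕ) : ∃ N, ∀ L ≥ N, ∀ l B d : ℕ, l = L * (L + 1) →
    B = 1 + h * (2 * (2 * l * (L + 1)) + 4) → d = 2 * l * (h * B) →
    4 * l * (d + 1) + 2 * d + 2 * B + h * B + 2 ≤ 2 ^ L := by
  obtain ⟨N, hN⟩ := eventually_mul_pow_le_two_pow
    (2 * (4 * (2 * h * (1 + 8 * h) + 1) + 2 * (2 * h * (1 + 8 * h)) + 2 * (1 + 8 * h) +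
      h * (1 + 8 * h) + 2)) 7
  refine ⟨N, fun L hL l B d hl hB hd => ?_⟩
  have h1 := hN (L + 1) (by omega)
  set x := L + 1 with hx
  set a := 1 + 8 * h with ha
  have hx1 : 1 ≤ x := by omega
  have hlx : l ≤ x ^ 2 := by rw [hl, sq]; gcongr; omega
  have hBx : B ≤ a * x ^ 3 := by
    have : 1 ≤ x ^ 3 := Nat.one_le_pow _ _ hx1
    calc B ≤ 1 + h * (2 * (2 * x ^ 2 * x) + 4) := by rw [hB]; gcongr
      _ = 1 + h * (4 * x ^ 3 + 4) := by ring
      _ ≤ x ^ 3 + h * (4 * x ^ 3 + 4 * x ^ 3) := by gcongr; omega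
      _ = a * x ^ 3 := by rw [ha]; ring
  have hdx : d ≤ 2 * h * a * x ^ 5 := by
    calc d ≤ 2 * x ^ 2 * (h * (a * x ^ 3)) := by rw [hd]; gcongr
      _ = _ := by ring
  have h5 : 1 ≤ x ^ 5 := Nat.one_le_pow _ _ hx1
  have h7 : 1 ≤ x ^ 7 := Nat.one_le_pow _ _ hx1
  have h57 : x ^ 5 ≤ x ^ 7 := Nat.pow_le_pow_right hx1 (by norm_num)
  have h37 : x ^ 3 ≤ x ^ 7 := Nat.pow_le_pow_right hx1 (by norm_num)
  have key : 4 * l * (d + 1) + 2 * d + 2 * B + h * B + 2 ≤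
      (4 * (2 * h * a + 1) + 2 * (2 * h * a) + 2 * a + h * a + 2) * x ^ 7 := by
    calc 4 * l * (d + 1) + 2 * d + 2 * B + h * B + 2
        ≤ 4 * x ^ 2 * (2 * h * a * x ^ 5 + x ^ 5) + 2 * (2 * h * a * x ^ 7) +
          2 * (a * x ^ 7) + h * (a * x ^ 7) + 2 * x ^ 7 := by
          gcongr
          · exact hdx.trans (by gcongr)
          · exact hBx.trans (by gcongr)
          · exact hBx.trans (by gcongr)
          · omega
      _ = _ := by ring
  have h2 : 2 ^ x = 2 * 2 ^ L := by rw [hx]; ring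
  rw [h2, mul_assoc] at h1
  exact key.trans (Nat.le_of_mul_le_mul_left h1 two_pos)

/-- If every large set has a sparse cut, then deleting a small proportion of the vertices
leaves only small pieces. -/
theorem exists_fragmentation {G : SimpleGraph V} {L₀ : ℕ} (hL₀ : 1 ≤ L₀)
    (hcut : ∀ Y : Finset V, L₀ ≤ Nat.log 2 Y.card → ∃ S ⊆ Y, S.Nonempty ∧
      2 * S.card ≤ Y.card ∧
      Nat.log 2 Y.card * (Nat.log 2 Y.card + 1) * (nb G Y S).card ≤ S.card)
    (Y : Finset V) :
    ∃ X ⊆ Y, (X.card : ℝ) ≤ Y.card * max 0 (1 / L₀ - 1 / ((Nat.log 2 Y.card : ℝ) + 1)) ∧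
      ∀ P ⊆ Y \ X, P.Nonempty → ∃ Q ⊆ P, Q.Nonempty ∧ Q.card < 2 ^ L₀ ∧
        ∀ u ∈ Q, ∀ v ∈ P \ Q, ¬ G.Adj u v := by
  induction hn : Y.card using Nat.strong_induction_on generalizing Y with
  | _ n ih =>
  by_cases hL : L₀ ≤ Nat.log 2 Y.card
  · obtain ⟨S, hSY, hSne, hS2, hSnb⟩ := hcut Y hL
    have hSpos := Finset.card_pos.2 hSne
    set N := nb G Y S with hN
    have hNY : N ⊆ Y := fun v hv => (mem_nb.1 hv).1
    have hSN : Disjoint S N := Finset.disjoint_right.2 fun v hv => (mem_nb.1 hv).2.1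
    set R := (Y \ S) \ N with hR
    have hRY : R ⊆ Y := Finset.sdiff_subset.trans Finset.sdiff_subset
    have hcard : S.card + N.card + R.card = Y.card := by
      have h1 : R.card = (Y \ S).card - N.card := Finset.card_sdiff_of_subset fun v hv =>
        Finset.mem_sdiff.2 ⟨hNY hv, Finset.disjoint_right.1 hSN hv⟩
      have h2 : (Y \ S).card = Y.card - S.card := Finset.card_sdiff_of_subset hSY
      have h3 : S.card + N.card ≤ Y.card := by
        rw [← Finset.card_union_of_disjoint hSN]
        exact Finset.card_le_card (Finset.union_subset hSY hNY)
      omega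
    obtain ⟨X₁, hX₁, hX₁c, hX₁P⟩ := ih S.card (by omega) S rfl
    obtain ⟨X₂, hX₂, hX₂c, hX₂P⟩ := ih R.card (by omega) R rfl
    refine ⟨X₁ ∪ X₂ ∪ N, Finset.union_subset (Finset.union_subset (hX₁.trans hSY)
      (hX₂.trans hRY)) hNY, ?_, ?_⟩
    · have hc : (((X₁ ∪ X₂ ∪ N).card : ℕ) : ℝ) ≤ X₁.card + X₂.card + N.card := by
        have h1 := Finset.card_union_le (X₁ ∪ X₂) N
        have h2 := Finset.card_union_le X₁ X₂
        exact_mod_cast (by omega : (X₁ ∪ X₂ ∪ N).card ≤ X₁.card + X₂.card + N.card)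
      rw [← hn]
      set L := Nat.log 2 Y.card with hLdef
      have hL1 : (1 : ℝ) ≤ L := by exact_mod_cast hL₀.trans hL
      have hlogS : Nat.log 2 S.card + 1 ≤ L := by
        rw [← Nat.log_mul_base (by norm_num) (by omega)]
        exact Nat.log_mono_right (by omega)
      have hlogR : Nat.log 2 R.card ≤ L := Nat.log_mono_right (by omega)
      have hL₀' : (1 : ℝ) ≤ L₀ := by exact_mod_cast hL₀
      have hLL : (L₀ : ℝ) ≤ L := by exact_mod_cast hL
      have e1 : max 0 (1 / (L₀ : ℝ) - 1 / ((Nat.log 2 S.card : ℝ) + 1)) ≤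
          1 / (L₀ : ℝ) - 1 / L := by
        have h1 : 1 / (L : ℝ) ≤ 1 / L₀ := one_div_le_one_div_of_le (by linarith) hLL
        have h2 : 1 / (L : ℝ) ≤ 1 / ((Nat.log 2 S.card : ℝ) + 1) :=
          one_div_le_one_div_of_le (by positivity) (by exact_mod_cast hlogS)
        exact max_le (by linarith) (by linarith)
      have e2 : max 0 (1 / (L₀ : ℝ) - 1 / ((Nat.log 2 R.card : ℝ) + 1)) ≤
          max 0 (1 / (L₀ : ℝ) - 1 / ((L : ℝ) + 1)) := by
        have h2 : 1 / ((L : ℝ) + 1) ≤ 1 / ((Nat.log 2 R.card : ℝ) + 1) :=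
          one_div_le_one_div_of_le (by positivity) (by exact_mod_cast Nat.succ_le_succ hlogR)
        exact max_le_max le_rfl (by linarith)
      have e3 : (N.card : ℝ) ≤ S.card * (1 / L - 1 / ((L : ℝ) + 1)) := by
        have h1 : (L : ℝ) * (L + 1) * N.card ≤ S.card := by exact_mod_cast hSnb
        have h2 : (1 : ℝ) / L - 1 / ((L : ℝ) + 1) = 1 / (L * (L + 1)) := by
          field_simp
          ring
        rw [h2, mul_one_div, le_div_iff₀ (by positivity)]
        linarith
      have e4 := le_max_right 0 (1 / (L₀ : ℝ) - 1 / ((L : ℝ) + 1))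
      have e5 := le_max_left 0 (1 / (L₀ : ℝ) - 1 / ((L : ℝ) + 1))
      set f := max 0 (1 / (L₀ : ℝ) - 1 / ((L : ℝ) + 1))
      have hcard' : (S.card : ℝ) + N.card + R.card = Y.card := by exact_mod_cast hcard
      have b1 := hX₁c.trans (mul_le_mul_of_nonneg_left e1 (Nat.cast_nonneg S.card))
      have b2 := hX₂c.trans (mul_le_mul_of_nonneg_left e2 (Nat.cast_nonneg R.card))
      have b3 := mul_le_mul_of_nonneg_left e4 (Nat.cast_nonneg (α := ℝ) S.card)
      have b4 := mul_nonneg (Nat.cast_nonneg (α := ℝ) N.card) e5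
      rw [← hcard']
      linarith
    · intro P hP hPne
      have hPmem : ∀ v ∈ P, v ∈ S \ X₁ ∨ v ∈ R \ X₂ := by
        intro v hv
        have h1 := hP hv
        simp only [hR, Finset.mem_sdiff, Finset.mem_union, not_or] at h1 ⊢
        tauto
      by_cases hPS : (P ∩ S).Nonempty
      · obtain ⟨Q, hQ, hQne, hQc, hQadj⟩ := hX₁P (P ∩ S) (fun v hv => by
          obtain ⟨h1, h2⟩ := Finset.mem_inter.1 hv
          rcases hPmem v h1 with h | h
          · exact h
          · simp only [hR, Finset.mem_sdiff] at h
            tauto) hPS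
        refine ⟨Q, hQ.trans Finset.inter_subset_left, hQne, hQc, fun u hu v hv huv => ?_⟩
        obtain ⟨hvP, hvQ⟩ := Finset.mem_sdiff.1 hv
        by_cases hvS : v ∈ S
        · exact hQadj u hu v
            (Finset.mem_sdiff.2 ⟨Finset.mem_inter.2 ⟨hvP, hvS⟩, hvQ⟩) huv
        · have hvY := (Finset.mem_sdiff.1 (hP hvP)).1
          have hvN : v ∈ N :=
            mem_nb.2 ⟨hvY, hvS, u, (Finset.mem_inter.1 (hQ hu)).2, huv⟩
          exact (Finset.mem_sdiff.1 (hP hvP)).2 (Finset.mem_union_right _ hvN)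
      · refine hX₂P P (fun v hv => (hPmem v hv).resolve_left fun h => ?_) hPne
        exact hPS ⟨v, Finset.mem_inter.2 ⟨hv, (Finset.mem_sdiff.1 h).1⟩⟩
  · refine ⟨∅, by simp, ?_, fun P hP hPne => ⟨P, subset_rfl, hPne, ?_, by simp⟩⟩
    · rw [Finset.card_empty, Nat.cast_zero]
      exact mul_nonneg (Nat.cast_nonneg _) (le_max_left _ _)
    · refine (Finset.card_le_card (hP.trans Finset.sdiff_subset)).trans_lt ?_
      exact Nat.lt_pow_of_log_lt (by norm_num) (not_le.1 hL)

/-- Graphs without an `H`-minor can be broken into pieces of bounded size by deleting a small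
proportion of the vertices. -/
theorem exists_fragmentation_of_minor_free {W : Type} [Fintype W] (H : SimpleGraph W)
    {ε : ℝ} (hε : 0 < ε) : ∃ C : ℕ, ∀ (n : ℕ) (G : SimpleGraph (Fin n)), ¬ IsMinorOf H G →
      ∃ X : Finset (Fin n), (X.card : ℝ) ≤ ε * n ∧
        ∀ P : Finset (Fin n), Disjoint P X → P.Nonempty → ∃ Q ⊆ P, Q.Nonempty ∧ Q.card ≤ C ∧
          ∀ u ∈ Q, ∀ v ∈ P \ Q, ¬ G.Adj u v := by
  obtain ⟨N, hN⟩ := eventually_parameters_le (Fintype.card W)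
  obtain ⟨M, hM⟩ := exists_nat_ge (1 / ε)
  set L₀ := max 1 (max N M) with hL₀
  have h1 : 1 ≤ L₀ := le_max_left _ _
  have h2 : N ≤ L₀ := (le_max_left _ _).trans (le_max_right _ _)
  have h3 : M ≤ L₀ := (le_max_right _ _).trans (le_max_right _ _)
  refine ⟨2 ^ L₀, fun n G hG => ?_⟩
  obtain ⟨X, -, hXc, hX⟩ := exists_fragmentation (G := G) h1 (fun Y hY => by
    have hYpos : Y.card ≠ 0 := by
      intro h0
      rw [h0, Nat.log_zero_right] at hY
      omega
    exact exists_sparse_cut (h := Fintype.card W) (L := Nat.log 2 Y.card)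
      (Nat.mul_pos (by omega) (by omega)) le_rfl le_rfl
      (Nat.lt_pow_succ_log_self (by norm_num) _)
      ((hN _ (h2.trans hY) _ _ _ rfl rfl rfl).trans (Nat.pow_log_le_self 2 hYpos))
      (fun F hF hFc => hG (hF.isMinorOf H hFc))) Finset.univ
  refine ⟨X, hXc.trans ?_, fun P hP hPne => ?_⟩
  · rw [Finset.card_univ, Fintype.card_fin, mul_comm]
    refine mul_le_mul_of_nonneg_right (max_le hε.le ?_) (Nat.cast_nonneg n)
    have hM' : 1 / ε ≤ L₀ := hM.trans (by exact_mod_cast h3)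
    have h4 : 1 / (L₀ : ℝ) ≤ ε := by
      rw [div_le_iff₀ hε] at hM'
      rw [div_le_iff₀ (by exact_mod_cast h1)]
      linarith
    have h5 : 0 ≤ 1 / ((Nat.log 2 n : ℝ) + 1) := by positivity
    linarith
  · obtain ⟨Q, a, b, c, e⟩ := hX P (fun v hv => by
      simpa using Finset.disjoint_left.1 hP hv) hPne
    exact ⟨Q, a, b, c.le, e⟩

end Percolation

namespace Percolation

/-- Every island meets every percolating set. -/
theorem IsIsland.inter_nonempty {V : Type*} [Finite V] {G : SimpleGraph V} {t : ℕ} {S A : Set V}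
    (hS : IsIsland G t S) (hA : Percolates G t A) : (S ∩ A).Nonempty := by
  by_contra hne
  have key : ∀ v, PercolationActive G t A v → v ∉ S := by
    intro v hv
    induction hv with
    | base v hv => exact fun hvS => hne ⟨v, hvS, hv⟩
    | step v N hN hadj _ ih =>
      intro hvS
      have h1 := hS.2 v hvS
      have h2 : (N : Set V) ⊆ G.neighborSet v \ S := fun u hu => ⟨hadj u hu, ih u hu⟩
      have h3 := Set.ncard_le_ncard h2 (Set.toFinite _)
      rw [Set.ncard_coe_finset] at h3
      omega
  obtain ⟨v, hv⟩ := hS.1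
  exact key v (hA v) hv

/-- The vertices which never become active form an island. -/
theorem isIsland_inactive {V : Type*} [Finite V] {G : SimpleGraph V} {t : ℕ} {A : Set V}
    (hA : ¬ Percolates G t A) : IsIsland G t {v | ¬ PercolationActive G t A v} := by
  refine ⟨not_forall.1 hA, fun v hv => ?_⟩
  by_contra hlt
  refine hv (.step v (Set.toFinite (G.neighborSet v \ {v | ¬ PercolationActive G t A v})).toFinset
    ?_ ?_ ?_)
  · rw [← Set.ncard_eq_toFinset_card]
    exact not_lt.1 hlt
  · intro u hu
    exact ((Set.Finite.mem_toFinset _).1 hu).1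
  · intro u hu
    exact not_not.1 ((Set.Finite.mem_toFinset _).1 hu).2

/-- A nonempty part of an island with no edges to the rest of it is an island. -/
theorem IsIsland.of_subset {V : Type*} [Finite V] {G : SimpleGraph V} {t : ℕ} {S Q : Set V}
    (hS : IsIsland G t S) (hQ : Q.Nonempty) (hQS : Q ⊆ S)
    (hadj : ∀ u ∈ Q, ∀ v ∈ S \ Q, ¬ G.Adj u v) : IsIsland G t Q := by
  refine ⟨hQ, fun v hv => (Set.ncard_le_ncard ?_ (Set.toFinite _)).trans_lt (hS.2 v (hQS hv))⟩
  exact fun u hu => ⟨hu.1, fun huS => hadj v hv u ⟨huS, hu.2⟩ hu.1⟩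

theorem HasDisjointIslands.le_ncard {V : Type*} [Finite V] {G : SimpleGraph V} {t k : ℕ}
    {A : Set V} (h : HasDisjointIslands G t k) (hA : Percolates G t A) : k ≤ A.ncard := by
  obtain ⟨f, hf, hdisj⟩ := h
  choose g hg using fun i => IsIsland.inter_nonempty (hf i) hA
  have hinj : Function.Injective g := by
    intro i j hij
    by_contra hne
    exact Set.disjoint_left.1 (hdisj hne) (hg i).1 (hij ▸ (hg j).1)
  have h1 : (Set.range g).ncard = k := by
    rw [Set.ncard_range_of_injective hinj, Nat.card_eq_fintype_card, Fintype.card_fin]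
  rw [← h1]
  exact Set.ncard_le_ncard (Set.range_subset_iff.2 fun i => (hg i).2) (Set.toFinite _)

/-- If deleting `X` leaves only pieces of size at most `C`, then some percolating set consists
of `X` and at most `C` vertices for each of `k` disjoint islands. -/
theorem exists_percolating_of_fragmentation {V : Type*} [Fintype V] [DecidableEq V]
    {G : SimpleGraph V} (t : ℕ) {C : ℕ} {X : Finset V}
    (hX : ∀ P : Finset V, Disjoint P X → P.Nonempty → ∃ Q ⊆ P, Q.Nonempty ∧ Q.card ≤ C ∧
      ∀ u ∈ Q, ∀ v ∈ P \ Q, ¬ G.Adj u v) :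
    ∃ (k : ℕ) (A : Finset V), HasDisjointIslands G t k ∧ A.card ≤ X.card + k * C ∧
      Percolates G t (A : Set V) := by
  classical
  obtain ⟨F, hF, hmax⟩ := Finset.exists_max_image
    (Finset.univ.filter fun F : Finset (Finset V) =>
      (∀ T ∈ F, IsIsland G t (T : Set V) ∧ T.card ≤ C) ∧
      ∀ T ∈ F, ∀ T' ∈ F, T ≠ T' → Disjoint T T') Finset.card ⟨∅, by simp⟩
  obtain ⟨-, hF1, hF2⟩ := Finset.mem_filter.1 hF
  refine ⟨F.card, X ∪ F.biUnion id, ?_, ?_, ?_⟩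
  · refine ⟨fun i => ((F.equivFin.symm i : Finset V) : Set V),
      fun i => (hF1 _ (F.equivFin.symm i).2).1, fun i j hij => ?_⟩
    refine Finset.disjoint_coe.2 (hF2 _ (F.equivFin.symm i).2 _ (F.equivFin.symm j).2 fun h => ?_)
    exact hij (F.equivFin.symm.injective (Subtype.ext h))
  · refine (Finset.card_union_le _ _).trans (Nat.add_le_add_left ?_ _)
    exact Finset.card_biUnion_le_card_mul F id C fun T hT => (hF1 T hT).2
  · by_contra hA
    have hI := isIsland_inactive hA
    set Z := {v | ¬ PercolationActive G t (↑(X ∪ F.biUnion id)) v} with hZ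
    have hZA : ∀ v ∈ Z, v ∉ X ∪ F.biUnion id := fun v hv hvA =>
      hv (.base v (Finset.mem_coe.2 hvA))
    have hZmem : ∀ v, v ∈ Z.toFinite.toFinset ↔ v ∈ Z := fun v => Set.Finite.mem_toFinset _
    obtain ⟨Q, hQ, hQne, hQc, hQadj⟩ := hX Z.toFinite.toFinset
      (Finset.disjoint_left.2 fun v hv hvX =>
        hZA v ((hZmem v).1 hv) (Finset.mem_union_left _ hvX))
      (hI.1.imp fun v hv => (hZmem v).2 hv)
    have hQI : IsIsland G t (Q : Set V) :=
      IsIsland.of_subset hI hQne (fun v hv => (hZmem v).1 (hQ hv)) fun u hu v hv =>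
        hQadj u hu v (Finset.mem_sdiff.2 ⟨(hZmem v).2 hv.1, hv.2⟩)
    have hQF : ∀ T ∈ F, Disjoint T Q := fun T hT => Finset.disjoint_left.2 fun v hv hvQ =>
      hZA v ((hZmem v).1 (hQ hvQ))
        (Finset.mem_union_right _ (Finset.mem_biUnion.2 ⟨T, hT, hv⟩))
    have hQnotin : Q ∉ F := fun h => by
      obtain ⟨v, hv⟩ := hQne
      exact Finset.disjoint_left.1 (hQF Q h) hv hv
    have := hmax (insert Q F) (by
      refine Finset.mem_filter.2 ⟨Finset.mem_univ _, ?_, ?_⟩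
      · exact (Finset.forall_mem_insert _ _ _).2 ⟨⟨hQI, hQc⟩, hF1⟩
      · intro T hT T' hT' hne
        rcases Finset.mem_insert.1 hT with rfl | hTF
        · exact (hQF T' ((Finset.mem_insert.1 hT').resolve_left hne.symm)).symm
        · rcases Finset.mem_insert.1 hT' with rfl | hTF'
          · exact hQF T hTF
          · exact hF2 T hTF T' hTF' hne)
    rw [Finset.card_insert_of_notMem hQnotin] at this
    omega

end Percolation

/-- for a subgraph-closed class `𝒢` of `H`-minor-free graphs and `t ≥ 1`,
`𝒢` has linearly many pairwise disjoint `t`-islands iff `𝒢` is uniformly resistant to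
`t`-percolation; i.e. `pcol_⋆(𝒢) = p(𝒢)`. -/
theorem stmt11 {W : Type} [Fintype W] (H : SimpleGraph W)
    (𝒢 : ∀ n : ℕ, SimpleGraph (Fin n) → Prop) (hclosed : SubgraphClosed 𝒢)
    (hfree : ∀ (n : ℕ) (G : SimpleGraph (Fin n)), 𝒢 n G → ¬ IsMinorOf H G)
    (t : ℕ) (ht : 1 ≤ t) :
    (∃ ε : ℝ, 0 < ε ∧ ∀ (n : ℕ) (G : SimpleGraph (Fin n)), 𝒢 n G →
        ∃ k : ℕ, ε * n ≤ (k : ℝ) ∧ HasDisjointIslands G t k) ↔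
    (∃ ε : ℝ, 0 < ε ∧ ∀ (n : ℕ) (G : SimpleGraph (Fin n)), 𝒢 n G → 0 < n →
        ∀ A : Set (Fin n), (A.ncard : ℝ) ≤ ε * n → ¬ Percolates G t A) := by
  constructor
  · rintro ⟨ε, hε, h⟩
    refine ⟨ε / 2, by positivity, fun n G hG hn A hA hperc => ?_⟩
    obtain ⟨k, hk, hisl⟩ := h n G hG
    have h1 : (k : ℝ) ≤ A.ncard := by
      exact_mod_cast Percolation.HasDisjointIslands.le_ncard hisl hperc
    have h2 : 0 < ε * (n : ℝ) := mul_pos hε (by exact_mod_cast hn)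
    linarith
  · rintro ⟨ε, hε, h⟩
    obtain ⟨C, hC⟩ := Percolation.exists_fragmentation_of_minor_free H (half_pos hε)
    refine ⟨ε / 2 / (C + 1), by positivity, fun n G hG => ?_⟩
    obtain ⟨X, hXc, hX⟩ := hC n G (hfree n G hG)
    obtain ⟨k, A, hk, hAc, hA⟩ := Percolation.exists_percolating_of_fragmentation t hX
    refine ⟨k, ?_, hk⟩
    rcases Nat.eq_zero_or_pos n with rfl | hn
    · simp
    have h1 : ε * n < A.card := by
      by_contra hle
      exact h n G hG hn A (by rw [Set.ncard_coe_finset]; exact not_lt.1 hle) hA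
    have h2 : (A.card : ℝ) ≤ X.card + k * C := by exact_mod_cast hAc
    rw [div_mul_eq_mul_div, div_le_iff₀ (by positivity)]
    have h3 : (0 : ℝ) ≤ k := Nat.cast_nonneg k
    linarith
end

section
/- For every finite graph H, every integer t ≥ 1 and every real α > 0 there exists a real δ > 0 satisfying the following: every H-minor-free finite graph G with |E(G)| ≤ (t − α)·|V(G)| contains at least δ·|V(G)| pairwise disjoint t-islands. -/
open SimpleGraph

namespace SimpleGraph

variable {V : Type*} {G G' : SimpleGraph V}

/-- The spanning subgraph of `G` whose edges are those with both ends in `S`. -/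
def within (G : SimpleGraph V) (S : Set V) : SimpleGraph V where
  Adj u v := G.Adj u v ∧ u ∈ S ∧ v ∈ S
  symm := ⟨fun _ _ h => ⟨h.1.symm, h.2.2, h.2.1⟩⟩
  loopless := ⟨fun _ h => h.1.ne rfl⟩

lemma within_le (S : Set V) : G.within S ≤ G := fun _ _ h => h.1

lemma within_mono {S T : Set V} (h : S ⊆ T) : G.within S ≤ G.within T :=
  fun _ _ ha => ⟨ha.1, h ha.2.1, h ha.2.2⟩

/-- The vertices `u` and `v` are joined by a walk of length at most `r`. -/
def Near (G : SimpleGraph V) (r : ℕ) (u v : V) : Prop := ∃ p : G.Walk u v, p.length ≤ r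

namespace Near

lemma refl (G : SimpleGraph V) (r : ℕ) (v : V) : G.Near r v v := ⟨Walk.nil, by simp⟩

lemma symm {r : ℕ} {u v : V} (h : G.Near r u v) : G.Near r v u := by
  obtain ⟨p, hp⟩ := h
  exact ⟨p.reverse, by simpa using hp⟩

lemma trans {r s : ℕ} {u v w : V} (h : G.Near r u v) (h' : G.Near s v w) :
    G.Near (r + s) u w := by
  obtain ⟨p, hp⟩ := h
  obtain ⟨q, hq⟩ := h'
  exact ⟨p.append q, by rw [Walk.length_append]; omega⟩

lemma mono {r s : ℕ} {u v : V} (hG : G ≤ G') (hr : r ≤ s) (h : G.Near r u v) :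
    G'.Near s u v := by
  obtain ⟨p, hp⟩ := h
  exact ⟨p.mapLe hG, by simpa using hp.trans hr⟩

lemma of_adj {u v : V} (h : G.Adj u v) : G.Near 1 u v := ⟨h.toWalk, by simp⟩

lemma mem {S : Set V} {r : ℕ} {u v : V} (h : (G.within S).Near r u v) (hu : u ∈ S) : v ∈ S := by
  obtain ⟨p, -⟩ := h
  induction p with
  | nil => exact hu
  | cons ha _ ih => exact ih ha.2.2

end Near

/-- A set is connected if each of its vertices is joined to a fixed one inside the set. -/
lemma induce_connected_of_walks {S : Set V} {u : V} (hu : u ∈ S)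
    (h : ∀ v ∈ S, ∃ p : G.Walk u v, ∀ x ∈ p.support, x ∈ S) : (G.induce S).Connected := by
  refine induce_connected_of_patches u hu fun {v} hv => ?_
  obtain ⟨p, hp⟩ := h v hv
  exact ⟨{x | x ∈ p.support}, hp, p.start_mem_support, p.end_mem_support,
    (p.connected_induce_support).preconnected _ _⟩

lemma support_subset_of_within {S : Set V} {u v : V} (p : (G.within S).Walk u v) (hu : u ∈ S) :
    ∀ x ∈ p.support, x ∈ S := by
  induction p with
  | nil => simpa using hu
  | cons ha _ ih =>
    intro x hx
    rw [Walk.support_cons, List.mem_cons] at hx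
    rcases hx with rfl | hx
    · exact hu
    · exact ih ha.2.2 x hx

lemma induce_connected_of_within {S : Set V} {u : V} (hu : u ∈ S)
    (h : ∀ v ∈ S, (G.within S).Reachable u v) : (G.induce S).Connected := by
  refine induce_connected_of_walks hu fun v hv => ?_
  obtain ⟨p⟩ := h v hv
  exact ⟨p.mapLe (within_le S), by simpa using support_subset_of_within p hu⟩

lemma induce_ball_connected (hG : G ≤ G') (r : ℕ) (v : V) :
    (G'.induce {u | G.Near r v u}).Connected := by
  classical
  refine induce_connected_of_walks (Near.refl G r v) fun u hu => ?_
  obtain ⟨p, hp⟩ := hu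
  refine ⟨p.mapLe hG, fun x hx => ?_⟩
  have hx' : x ∈ p.support := by simpa using hx
  exact ⟨p.takeUntil x hx', (p.length_takeUntil_le_length hx').trans hp⟩

lemma induce_union_connected_of_adj {S T : Set V} (hS : (G.induce S).Connected)
    (hT : (G.induce T).Connected) {u v : V} (hu : u ∈ S) (hv : v ∈ T) (h : G.Adj u v) :
    (G.induce (S ∪ T)).Connected := by
  have hT' : (G.induce ({u, v} ∪ T)).Connected :=
    induce_union_connected (induce_pair_connected_of_adj h).preconnected hT.preconnected
      ⟨v, by simp, hv⟩
  have hST := induce_union_connected hS.preconnected hT'.preconnected ⟨u, hu, by simp⟩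
  have heq : S ∪ ({u, v} ∪ T) = S ∪ T := by
    ext x
    simp only [Set.mem_union, Set.mem_insert_iff, Set.mem_singleton_iff]
    constructor
    · rintro (hx | (rfl | rfl) | hx) <;> tauto
    · tauto
  rwa [heq] at hST

/-- A breadth-first layering of the subgraph induced by `P`, with a single vertex in level `0`. -/
structure IsLayering (G : SimpleGraph V) (P : Set V) (l : V → ℕ) : Prop where
  le_succ : ∀ u ∈ P, ∀ v ∈ P, G.Adj u v → l v ≤ l u + 1
  exists_pred : ∀ v ∈ P, 0 < l v → ∃ u ∈ P, G.Adj v u ∧ l u + 1 = l v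
  root_unique : ∀ u ∈ P, ∀ v ∈ P, l u = 0 → l v = 0 → u = v

lemma IsLayering.le_of_near {P : Set V} {l : V → ℕ} (hl : G.IsLayering P l) {r : ℕ} {u v : V}
    (h : (G.within P).Near r u v) : l v ≤ l u + r := by
  obtain ⟨p, hp⟩ := h
  refine le_trans ?_ (Nat.add_le_add_left hp _)
  clear hp
  induction p with
  | nil => simp
  | cons ha _ ih =>
    have := hl.le_succ _ ha.2.1 _ ha.2.2 ha.1
    rw [Walk.length_cons]
    omega

/-- If one can always go down one level inside `Q` as long as the level exceeds `c`, then one can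
go down any number of levels not leading below `c`. -/
lemma exists_near_descent {Q : Set V} {l : V → ℕ} {c : ℕ}
    (h : ∀ v ∈ Q, c < l v → ∃ u ∈ Q, G.Adj v u ∧ l u + 1 = l v) (k : ℕ) :
    ∀ v ∈ Q, c + k ≤ l v → ∃ u ∈ Q, l u + k = l v ∧ (G.within Q).Near k v u := by
  induction k with
  | zero => exact fun v hv _ => ⟨v, hv, rfl, Near.refl _ _ _⟩
  | succ k ih =>
    intro v hv hk
    obtain ⟨u, hu, hul, hvu⟩ := ih v hv (by omega)
    obtain ⟨w, hw, huw, hwl⟩ := h u hu (by omega)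
    exact ⟨w, hw, by omega, hvu.trans (Near.of_adj ⟨huw, hu, hw⟩)⟩

/-- `K` lies in `τ + 1` consecutive levels of a breadth-first layering of `P`, and is closed under
descending inside these levels. -/
def IsChop (G : SimpleGraph V) (τ : ℕ) (P K : Set V) : Prop :=
  ∃ (l : V → ℕ) (c : ℕ), G.IsLayering P l ∧ K ⊆ P ∧ (∀ v ∈ K, c ≤ l v ∧ l v ≤ c + τ) ∧
    ∀ v ∈ K, ∀ u ∈ P, G.Adj v u → c ≤ l u → l u ≤ l v → u ∈ K

/-- `K` is obtained by `s` successive chops. -/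
inductive IsChopped (G : SimpleGraph V) (τ : ℕ) : ℕ → Set V → Prop
  | zero (K : Set V) : IsChopped G τ 0 K
  | succ {s : ℕ} {P K : Set V} : IsChopped G τ s P → G.IsChop τ P K → IsChopped G τ (s + 1) K

/-- A model of the complete bipartite graph with parts of sizes `m` and `s` inside `P`, such that
the `m` branch sets `X j` contain balls of radius `τ` of the subgraph induced by `P`, with centers
pairwise at distance more than `R` in `G`. -/
structure FatModel (G : SimpleGraph V) (τ m s R : ℕ) (P : Set V) where
  v : Fin m → V
  X : Fin m → Set V
  B : Fin s → Set V
  v_mem : ∀ j, v j ∈ P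
  X_subset : ∀ j, X j ⊆ P
  B_subset : ∀ i, B i ⊆ P
  ball_subset : ∀ j u, (G.within P).Near τ (v j) u → u ∈ X j
  X_connected : ∀ j, (G.induce (X j)).Connected
  B_connected : ∀ i, (G.induce (B i)).Connected
  X_disjoint : ∀ i j, i ≠ j → Disjoint (X i) (X j)
  B_disjoint : ∀ i j, i ≠ j → Disjoint (B i) (B j)
  X_B_disjoint : ∀ j i, Disjoint (X j) (B i)
  adj : ∀ j i, ∃ x ∈ X j, ∃ y ∈ B i, G.Adj x y
  far : ∀ i j, i ≠ j → ¬ G.Near R (v i) (v j)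

lemma FatModel.exists_of_chop {τ m s R : ℕ} {P K : Set V} (hm : 2 ≤ m) (h : G.IsChop τ P K)
    (M : G.FatModel τ m s (R + (6 * τ + 2)) K) : Nonempty (G.FatModel τ m (s + 1) R P) := by
  obtain ⟨l, c, hl, hKP, hKl, hK⟩ := h
  have hpred := hl.exists_pred
  have hroot : ∀ v ∈ P, ∃ u ∈ P, l u = 0 ∧ G.Near (l v) v u := by
    intro v hv
    obtain ⟨u, hu, hul, hvu⟩ := exists_near_descent (c := 0) hpred (l v) v hv (by omega)
    exact ⟨u, hu, by omega, hvu.mono (within_le _) le_rfl⟩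
  have hc : 2 * τ + 2 ≤ c := by
    by_contra! hc
    refine M.far ⟨0, by omega⟩ ⟨1, by omega⟩ (by simp) ?_
    generalize (⟨0, by omega⟩ : Fin m) = i
    generalize (⟨1, by omega⟩ : Fin m) = j
    obtain ⟨x, hx, hx0, hix⟩ := hroot _ (hKP (M.v_mem i))
    obtain ⟨y, hy, hy0, hjy⟩ := hroot _ (hKP (M.v_mem j))
    obtain rfl := hl.root_unique x hx y hy hx0 hy0
    have h1 := (hKl _ (M.v_mem i)).2
    have h2 := (hKl _ (M.v_mem j)).2
    exact (hix.trans hjy.symm).mono le_rfl (by omega)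
  have key : ∀ j, ∃ x ∈ M.X j, ∃ q ∈ P, ∃ v' ∈ P, G.Adj x q ∧ l v' + τ + 1 = c ∧
      (G.within P).Near τ v' q ∧ G.Near (2 * τ + 1) (M.v j) v' := by
    intro j
    have hv := M.v_mem j
    have hvl := hKl _ hv
    obtain ⟨x, hx, hxl, hvx⟩ := exists_near_descent (Q := K) (c := c) (l := l) (G := G)
      (fun v hv hcv => by
        obtain ⟨u, hu, hvu, hul⟩ := hpred v (hKP hv) (by omega)
        exact ⟨u, hK v hv u hu hvu (by omega) (by omega), hvu, hul⟩)
      (l (M.v j) - c) (M.v j) hv (by omega)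
    obtain ⟨q, hq, hxq, hql⟩ := hpred x (hKP hx) (by omega)
    obtain ⟨w, hw, hwl, hqw⟩ := exists_near_descent (c := 0) hpred τ q hq (by omega)
    refine ⟨x, M.ball_subset j x (hvx.mono le_rfl (by omega)), q, hq, w, hw, hxq, by omega,
      hqw.symm, ?_⟩
    exact ((hvx.mono (within_le _) (by omega : _ ≤ τ)).trans
      ((Near.of_adj hxq).trans (hqw.mono (within_le _) le_rfl))).mono le_rfl (by omega)
  choose x hx q hq v' hv' hxq hv'l hv'q hvv' using key
  have hballP : ∀ j u, (G.within P).Near τ (v' j) u → u ∈ P := fun j u h => h.mem (hv' j)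
  have hball_le : ∀ j u, (G.within P).Near τ (v' j) u → l u < c ∧ c ≤ l u + 2 * τ + 1 := by
    intro j u h
    have h1 := hl.le_of_near h
    have h2 := hl.le_of_near h.symm
    have := hv'l j
    omega
  have hX_ball : ∀ i j u, u ∈ M.X i → ¬ (G.within P).Near τ (v' j) u := by
    intro i j u hu h
    have h1 := (hKl u (M.X_subset i hu)).1
    have h2 := (hball_le j u h).1
    omega
  refine ⟨{
    v := v'
    X := fun j => M.X j ∪ {u | (G.within P).Near τ (v' j) u}
    B := Fin.cons {u | u ∈ P ∧ l u + (2 * τ + 2) ≤ c} M.B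
    v_mem := hv'
    X_subset := fun j => Set.union_subset ((M.X_subset j).trans hKP) (hballP j)
    B_subset := Fin.cases (fun u hu => hu.1) (fun i => (M.B_subset i).trans hKP)
    ball_subset := fun j u hu => Or.inr hu
    X_connected := fun j => induce_union_connected_of_adj (M.X_connected j)
      (induce_ball_connected (within_le P) τ (v' j)) (hx j) (hv'q j) (hxq j)
    B_connected := ?_
    X_disjoint := ?_
    B_disjoint := ?_
    X_B_disjoint := ?_
    adj := ?_
    far := ?_ }⟩
  · refine Fin.cases ?_ M.B_connected
    obtain ⟨r, hr, hr0, -⟩ := hroot _ (hKP (M.v_mem ⟨0, by omega⟩))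
    refine induce_connected_of_within (u := r) ⟨hr, by omega⟩ fun u hu => ?_
    obtain ⟨w, hw, hwl, p, -⟩ := exists_near_descent (G := G) (c := 0) (l := l)
      (Q := {u | u ∈ P ∧ l u + (2 * τ + 2) ≤ c})
      (fun v hv h0 => by
        obtain ⟨u, hu, hvu, hul⟩ := hpred v hv.1 h0
        exact ⟨u, ⟨hu, by have := hv.2; omega⟩, hvu, hul⟩) (l u) u hu (by omega)
    obtain rfl := hl.root_unique r hr w hw.1 hr0 (by omega)
    exact ⟨p.reverse⟩
  · intro i j hij
    simp only [Set.disjoint_union_left, Set.disjoint_union_right]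
    refine ⟨⟨M.X_disjoint i j hij, ?_⟩, ?_, ?_⟩
    · exact Set.disjoint_left.2 fun u hu hu' => hX_ball j i u hu' hu
    · exact Set.disjoint_left.2 fun u hu hu' => hX_ball i j u hu hu'
    · refine Set.disjoint_left.2 fun u hu hu' => M.far i j hij ?_
      exact ((hvv' i).trans ((hu.mono (within_le _) le_rfl).trans
        ((hu'.symm.mono (within_le _) le_rfl).trans (hvv' j).symm))).mono le_rfl (by omega)
  · have h0 : ∀ i, Disjoint {u | u ∈ P ∧ l u + (2 * τ + 2) ≤ c} (M.B i) := fun i =>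
      Set.disjoint_left.2 fun u hu hu' => by
        have h1 := (hKl u (M.B_subset i hu')).1
        have h2 := hu.2
        omega
    refine Fin.cases (Fin.cases (fun h => (h rfl).elim) fun j _ => h0 j) fun i =>
      Fin.cases (fun _ => (h0 i).symm) fun j hij => M.B_disjoint i j fun h => hij (by rw [h])
  · intro j
    refine Fin.cases ?_ fun i => ?_
    · refine Set.disjoint_left.2 fun u hu hu' => ?_
      have h2 := hu'.2
      rcases hu with hu | hu
      · have h1 := (hKl u (M.X_subset j hu)).1
        omega
      · have h1 := (hball_le j u hu).2
        omega
    · refine Set.disjoint_union_left.2 ⟨M.X_B_disjoint j i, Set.disjoint_left.2 fun u hu hu' => ?_⟩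
      have h1 := (hKl u (M.B_subset i hu')).1
      have h2 := (hball_le j u hu).1
      omega
  · intro j
    refine Fin.cases ?_ fun i => ?_
    · have := hv'l j
      obtain ⟨w, hw, hwl, hnear⟩ := exists_near_descent (c := 0) hpred τ (v' j) (hv' j) (by omega)
      obtain ⟨y, hy, hwy, hyl⟩ := hpred w hw (by omega)
      exact ⟨w, Or.inr hnear, y, ⟨hy, by omega⟩, hwy⟩
    · obtain ⟨a, ha, b, hb, hab⟩ := M.adj j i
      exact ⟨a, Or.inl ha, b, hb, hab⟩
  · intro i j hij h
    refine M.far i j hij ?_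
    exact ((hvv' i).trans (h.trans (hvv' j).symm)).mono le_rfl (by omega)

lemma IsChopped.exists_fatModel {τ m s R : ℕ} {K : Set V} (hm : 2 ≤ m)
    (h : G.IsChopped τ s K) {k : ℕ} (M : G.FatModel τ m k (R + s * (6 * τ + 2)) K) :
    ∃ P, Nonempty (G.FatModel τ m (k + s) R P) := by
  induction h generalizing k with
  | zero K => exact ⟨K, ⟨by simpa using M⟩⟩
  | @succ s P K _ hc ih =>
    rw [Nat.succ_mul, ← Nat.add_assoc] at M
    obtain ⟨N⟩ := M.exists_of_chop hm hc
    rw [← Nat.add_assoc, Nat.add_right_comm]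
    exact ih N

/-- Pairwise far vertices in a set obtained by sufficiently many chops yield every small minor. -/
lemma IsChopped.isMinorOf {W : Type*} [Fintype W] (H : SimpleGraph W) {τ m : ℕ} {K : Set V}
    (hm : 2 ≤ m) (hW : Fintype.card W ≤ m) (h : G.IsChopped τ m K) (v : Fin m → V)
    (hv : ∀ j, v j ∈ K) (hfar : ∀ i j, i ≠ j → ¬ G.Near ((m + 1) * (6 * τ + 2)) (v i) (v j)) :
    IsMinorOf H G := by
  have hfar' : ∀ i j, i ≠ j → ¬ G.Near (2 * τ + m * (6 * τ + 2)) (v i) (v j) :=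
    fun i j hij hn => hfar i j hij (hn.mono le_rfl (by rw [Nat.add_mul]; omega))
  obtain ⟨P, ⟨M⟩⟩ := h.exists_fatModel (R := 2 * τ) (k := 0) hm {
    v := v
    X := fun j => {u | (G.within K).Near τ (v j) u}
    B := Fin.elim0
    v_mem := hv
    X_subset := fun j u hu => hu.mem (hv j)
    B_subset := fun i => i.elim0
    ball_subset := fun _ _ hu => hu
    X_connected := fun j => induce_ball_connected (within_le K) τ (v j)
    B_connected := fun i => i.elim0
    X_disjoint := fun i j hij => Set.disjoint_left.2 fun u hu hu' => hfar' i j hij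
      ((hu.mono (within_le _) le_rfl).trans (hu'.symm.mono (within_le _) le_rfl) |>.mono
        le_rfl (by omega))
    B_disjoint := fun i => i.elim0
    X_B_disjoint := fun _ i => i.elim0
    adj := fun _ i => i.elim0
    far := hfar' }
  rw [Nat.zero_add] at M
  obtain ⟨e⟩ : Nonempty (W ↪ Fin m) := Function.Embedding.nonempty_of_card_le (by simpa using hW)
  refine ⟨fun w => M.X (e w) ∪ M.B (e w), fun w => ?_, fun w => ?_, fun w w' hw => ?_,
    fun w w' _ => ?_⟩
  · exact ⟨M.v (e w), Or.inl (M.ball_subset _ _ (Near.refl _ _ _))⟩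
  · obtain ⟨x, hx, y, hy, hxy⟩ := M.adj (e w) (e w)
    exact induce_union_connected_of_adj (M.X_connected _) (M.B_connected _) hx hy hxy
  · have hne : e w ≠ e w' := fun h => hw (e.injective h)
    simp only [Set.disjoint_union_left, Set.disjoint_union_right]
    exact ⟨⟨M.X_disjoint _ _ hne, (M.X_B_disjoint _ _).symm⟩, M.X_B_disjoint _ _,
      M.B_disjoint _ _ hne⟩
  · obtain ⟨x, hx, y, hy, hxy⟩ := M.adj (e w) (e w')
    exact ⟨x, Or.inl hx, y, Or.inr hy, hxy⟩

/-- The vertices of the component of `v` in the subgraph induced by `S`. -/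
def compWithin (G : SimpleGraph V) (S : Set V) (v : V) : Set V := {u | (G.within S).Reachable v u}

lemma compWithin_subset {S : Set V} {v : V} (hv : v ∈ S) : G.compWithin S v ⊆ S := by
  rintro u ⟨p⟩
  exact support_subset_of_within p hv u p.end_mem_support

lemma compWithin_mono {S T : Set V} (h : G.within S ≤ G'.within T) (v : V) :
    G.compWithin S v ⊆ G'.compWithin T v := fun _ hu => hu.mono h

/-- The distance to a chosen root of the component. -/
noncomputable def level (G : SimpleGraph V) (v : V) : ℕ :=
  G.dist (G.connectedComponentMk v).out v

lemma reachable_out (v : V) : G.Reachable (G.connectedComponentMk v).out v :=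
  ConnectedComponent.exact (Quot.out_eq _)

lemma exists_adj_dist_add_one {r v : V} (h : G.Reachable r v) (h0 : 0 < G.dist r v) :
    ∃ u, G.Adj v u ∧ G.dist r u + 1 = G.dist r v := by
  obtain ⟨p, hp⟩ := h.symm.exists_walk_length_eq_dist
  rw [dist_comm] at hp
  cases p with
  | nil => simp only [Walk.length_nil] at hp; omega
  | @cons _ u _ hvu p =>
    refine ⟨u, hvu, ?_⟩
    have h1 := dist_le p.reverse
    obtain ⟨q, hq⟩ := (h.trans hvu.reachable).exists_walk_length_eq_dist
    have h2 := dist_le (q.concat hvu.symm)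
    rw [Walk.length_reverse] at h1
    rw [Walk.length_cons] at hp
    rw [Walk.length_concat, hq] at h2
    omega

lemma isLayering_level (S : Set V) {v : V} (hv : v ∈ S) :
    G.IsLayering (G.compWithin S v) (G.within S).level := by
  have hout : ∀ a b, (G.within S).Reachable a b →
      ((G.within S).connectedComponentMk a).out = ((G.within S).connectedComponentMk b).out :=
    fun a b hab => by rw [ConnectedComponent.eq.2 hab]
  refine ⟨fun a ha b hb hab => ?_, fun a ha h0 => ?_, fun a ha b hb ha0 hb0 => ?_⟩
  · have hab' : (G.within S).Adj a b := ⟨hab, compWithin_subset hv ha, compWithin_subset hv hb⟩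
    obtain ⟨p, hp⟩ := (reachable_out (G := G.within S) a).exists_walk_length_eq_dist
    have h := dist_le (p.concat hab')
    rw [Walk.length_concat, hp] at h
    rwa [level, ← hout a b hab'.reachable]
  · obtain ⟨b, hab, hb⟩ := exists_adj_dist_add_one (reachable_out (G := G.within S) a) h0
    refine ⟨b, ha.trans hab.reachable, hab.1, ?_⟩
    rwa [level, ← hout a b hab.reachable]
  · have h1 := ((reachable_out (G := G.within S) a).dist_eq_zero_iff).1 ha0
    have h2 := ((reachable_out (G := G.within S) b).dist_eq_zero_iff).1 hb0
    rw [← h1, ← h2]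
    exact hout a b (Reachable.trans (Reachable.symm ha) hb)

lemma mod_ne_zero_of_between {τ d x : ℕ} (hd : τ ∣ d) (h1 : d < x) (h2 : x < d + τ) :
    x % τ ≠ 0 := by
  intro h
  have h3 : τ ∣ x - d := Nat.dvd_sub (Nat.dvd_of_mod_eq_zero h) hd
  have := Nat.le_of_dvd (by omega) h3
  omega

/-- Removing every `τ`-th layer yields a chop of each component. -/
lemma isChop_compWithin {τ a : ℕ} (ha : a < τ) (S : Set V) {v : V}
    (hv : v ∈ {u ∈ S | ((G.within S).level u + a) % τ ≠ 0}) :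
    G.IsChop τ (G.compWithin S v)
      (G.compWithin {u ∈ S | ((G.within S).level u + a) % τ ≠ 0} v) := by
  set l := (G.within S).level with hl
  set S' := {u ∈ S | (l u + a) % τ ≠ 0} with hS'
  have hlay : G.IsLayering (G.compWithin S v) l := isLayering_level S hv.1
  have hsub : G.compWithin S' v ⊆ G.compWithin S v :=
    compWithin_mono (within_mono fun u hu => hu.1) v
  obtain ⟨d, hd, hd1, hd2⟩ : ∃ d, τ ∣ d ∧ d < l v + a ∧ l v + a < d + τ := by
    refine ⟨τ * ((l v + a) / τ), dvd_mul_right _ _, ?_, ?_⟩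
    · have h1 := Nat.div_add_mod (l v + a) τ
      have h2 := hv.2
      omega
    · have h1 := Nat.div_add_mod (l v + a) τ
      have h2 := Nat.mod_lt (l v + a) (by omega : τ > 0)
      omega
  have hband : ∀ u ∈ G.compWithin S' v, d < l u + a ∧ l u + a < d + τ := by
    have hwalk : ∀ u w, (G.within S').Walk u w → u ∈ G.compWithin S v →
        d < l u + a → l u + a < d + τ → d < l w + a ∧ l w + a < d + τ := by
      intro u w p
      induction p with
      | nil => exact fun _ h1 h2 => ⟨h1, h2⟩
      | @cons u x _ hux _ ih =>
        intro hu h1 h2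
        have hx : x ∈ G.compWithin S v :=
          Reachable.trans hu (Adj.reachable ⟨hux.1, hux.2.1.1, hux.2.2.1⟩)
        have h3 := hlay.le_succ u hu x hx hux.1
        have h4 := hlay.le_succ x hx u hu hux.1.symm
        have h5 : l x + a ≠ d := fun h => hux.2.2.2 (Nat.mod_eq_zero_of_dvd (h ▸ hd))
        have h6 : l x + a ≠ d + τ :=
          fun h => hux.2.2.2 (Nat.mod_eq_zero_of_dvd (h ▸ Nat.dvd_add hd dvd_rfl))
        exact ih hx (by omega) (by omega)
    rintro u ⟨p⟩
    exact hwalk v u p (Reachable.refl _) hd1 hd2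
  refine ⟨l, d + 1 - a, hlay, hsub, fun u hu => ?_, fun u hu w hw huw h1 h2 => ?_⟩
  · have := hband u hu
    omega
  · have := hband u hu
    have hw' : w ∈ S' :=
      ⟨compWithin_subset hv.1 hw, mod_ne_zero_of_between hd (by omega) (by omega)⟩
    exact Reachable.trans hu (Adj.reachable ⟨huw, compWithin_subset hv hu, hw'⟩)

lemma exists_isChopped [Finite V] (G : SimpleGraph V) {τ : ℕ} (hτ : 0 < τ) (s : ℕ) :
    ∃ S : Set V, τ * Sᶜ.ncard ≤ s * Nat.card V ∧
      ∀ v ∈ S, G.IsChopped τ s (G.compWithin S v) := by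
  classical
  have := Fintype.ofFinite V
  induction s with
  | zero => exact ⟨Set.univ, by simp, fun v _ => .zero _⟩
  | succ s ih =>
    obtain ⟨S, hS, hchop⟩ := ih
    set l := (G.within S).level with hl
    obtain ⟨r, hr, hcard⟩ := Finset.exists_card_fiber_le_of_card_le_nsmul
      (s := (Finset.univ : Finset V)) (t := Finset.range τ) (f := fun v => l v % τ)
      (b := (Nat.card V : ℚ) / τ) ⟨0, by simpa using hτ⟩ (by
        rw [Finset.card_range, Finset.card_univ, ← Nat.card_eq_fintype_card, nsmul_eq_mul,
          mul_div_cancel₀ _ (by positivity)])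
    rw [le_div_iff₀ (by positivity)] at hcard
    norm_cast at hcard
    rw [Finset.mem_range] at hr
    obtain ⟨a, ha, har⟩ : ∃ a < τ, ∀ x, (x + a) % τ = 0 → x % τ = r := by
      rcases Nat.eq_zero_or_pos r with rfl | h0
      · exact ⟨0, hτ, fun x hx => hx⟩
      · refine ⟨τ - r, by omega, fun x hx => ?_⟩
        have h1 : (x + (τ - r)) ≡ r + (τ - r) [MOD τ] := by
          rw [Nat.add_sub_cancel' hr.le]
          simpa [Nat.ModEq] using hx
        have h2 := Nat.ModEq.add_right_cancel' _ h1
        rwa [Nat.ModEq, Nat.mod_eq_of_lt hr] at h2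
    refine ⟨{u ∈ S | (l u + a) % τ ≠ 0}, ?_, fun v hv =>
      .succ (hchop v hv.1) (isChop_compWithin ha S hv)⟩
    have hsub : {u ∈ S | (l u + a) % τ ≠ 0}ᶜ ⊆
        Sᶜ ∪ ((Finset.univ.filter fun v => l v % τ = r : Finset V) : Set V) := by
      intro u hu
      by_cases huS : u ∈ S
      · right
        simp only [Finset.coe_filter, Finset.mem_univ, true_and, Set.mem_ofPred_eq]
        refine har _ ?_
        by_contra h
        exact hu ⟨huS, h⟩
      · exact Or.inl huS
    have h1 := (Set.ncard_le_ncard hsub (Set.toFinite _)).trans (Set.ncard_union_le _ _)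
    rw [Set.ncard_coe_finset] at h1
    have h2 := Nat.mul_le_mul_left τ h1
    rw [Nat.mul_add, Nat.mul_comm τ (Finset.card _)] at h2
    rw [Nat.succ_mul]
    omega

lemma card_near_le [Finite V] {D : ℕ} (hD : ∀ v, (G.neighborSet v).ncard ≤ D) (r : ℕ) (v : V) :
    {u | G.Near r v u}.ncard ≤ (D + 1) ^ r := by
  classical
  have := Fintype.ofFinite V
  suffices h : ∀ v, ∃ F : Finset V, F.card ≤ (D + 1) ^ r ∧ ∀ u, G.Near r v u → u ∈ F by
    obtain ⟨F, hF, hnear⟩ := h v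
    refine le_trans ?_ hF
    rw [← Set.ncard_coe_finset]
    exact Set.ncard_le_ncard hnear (Set.toFinite _)
  clear v
  induction r with
  | zero =>
    refine fun v => ⟨{v}, by simp, fun u hu => ?_⟩
    obtain ⟨p, hp⟩ := hu
    cases p with
    | nil => simp
    | cons _ _ => simp at hp
  | succ r ih =>
    choose F hF hnear using ih
    intro v
    refine ⟨(insert v (G.neighborSet v).toFinset).biUnion F, ?_, fun u hu => ?_⟩
    · rw [Nat.pow_succ']
      refine (Finset.card_biUnion_le_card_mul _ _ _ fun w _ => hF w).trans ?_
      refine Nat.mul_le_mul_right _ ((Finset.card_insert_le _ _).trans ?_)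
      rw [← Set.ncard_eq_toFinset_card']
      exact Nat.add_le_add_right (hD v) 1
    · obtain ⟨p, hp⟩ := hu
      rw [Finset.mem_biUnion]
      cases p with
      | nil => exact ⟨v, by simp, hnear _ _ (Near.refl _ _ _)⟩
      | @cons _ w _ hvw p =>
        exact ⟨w, by simp [hvw], hnear _ _ ⟨p, by simpa using hp⟩⟩

lemma exists_far_of_card {R C : ℕ} (hC : ∀ v, {u | G.Near R v u}.ncard ≤ C) [Finite V] (m : ℕ) :
    ∀ K : Set V, m * C < K.ncard →
      ∃ v : Fin m → V, (∀ j, v j ∈ K) ∧ ∀ i j, i ≠ j → ¬ G.Near R (v i) (v j) := by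
  induction m with
  | zero => exact fun K _ => ⟨Fin.elim0, fun i => i.elim0, fun i => i.elim0⟩
  | succ m ih =>
    intro K hK
    rw [Nat.succ_mul] at hK
    obtain ⟨x, hx⟩ : K.Nonempty := Set.nonempty_of_ncard_ne_zero (by omega)
    have h1 := Set.ncard_le_ncard_sdiff_add_ncard K {u | G.Near R x u}
    have h2 := hC x
    obtain ⟨v, hv, hfar⟩ := ih (K \ {u | G.Near R x u}) (by omega)
    refine ⟨Fin.cons x v, Fin.cases hx fun i => (hv i).1, ?_⟩
    refine Fin.cases (Fin.cases (fun h => (h rfl).elim) fun j _ => (hv j).2) fun i =>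
      Fin.cases (fun _ h => (hv i).2 h.symm) fun j hij => hfar i j fun h => hij (by rw [h])

lemma IsMinorOf.mono {W : Type*} {H : SimpleGraph W} (h : G ≤ G') (hH : IsMinorOf H G) :
    IsMinorOf H G' := by
  obtain ⟨μ, hne, hconn, hdisj, hadj⟩ := hH
  refine ⟨μ, hne, fun w => (hconn w).mono fun _ _ ha => h ha, hdisj, fun w w' hw => ?_⟩
  obtain ⟨u, hu, v, hv, huv⟩ := hadj hw
  exact ⟨u, hu, v, hv, h huv⟩

lemma card_high_degree_mul_le [Finite V] (G : SimpleGraph V) (D : ℕ) :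
    {v | D < (G.neighborSet v).ncard}.ncard * (D + 1) ≤ 2 * G.edgeSet.ncard := by
  classical
  have := Fintype.ofFinite V
  have h1 : {v | D < (G.neighborSet v).ncard} =
      ((Finset.univ.filter fun v => D < G.degree v : Finset V) : Set V) := by
    ext v
    simp [Set.ncard_eq_toFinset_card', ← card_neighborSet_eq_degree]
  rw [h1, Set.ncard_coe_finset, Set.ncard_eq_toFinset_card', ← edgeFinset,
    ← sum_degrees_eq_twice_card_edges]
  refine le_trans ?_
    (Finset.sum_le_sum_of_subset (Finset.filter_subset (fun v => D < G.degree v) _))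
  rw [← smul_eq_mul]
  exact Finset.card_nsmul_le_sum _ _ _ fun v hv => (Finset.mem_filter.1 hv).2

/-- Sparse graphs without a fixed minor can be broken into components of bounded size by the
removal of a small proportion of the vertices. -/
lemma exists_fragmentation {W : Type*} [Fintype W] (H : SimpleGraph W) (d : ℕ) {ε : ℝ}
    (hε : 0 < ε) : ∃ C : ℕ, ∀ (V : Type) [Finite V] (G : SimpleGraph V), ¬ IsMinorOf H G →
      G.edgeSet.ncard ≤ d * Nat.card V →
      ∃ S : Set V, (Sᶜ.ncard : ℝ) ≤ ε * Nat.card V ∧ ∀ v ∈ S, (G.compWithin S v).ncard ≤ C := by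
  set m := Fintype.card W + 2 with hm
  obtain ⟨τ, hτ⟩ := exists_nat_gt (2 * m / ε)
  obtain ⟨D, hD⟩ := exists_nat_gt (4 * d / ε)
  have hτ0 : (0 : ℝ) < τ := lt_of_le_of_lt (by positivity) hτ
  refine ⟨m * (D + 1) ^ ((m + 1) * (6 * τ + 2)), fun V _ G hG hE => ?_⟩
  set L := {v | D < (G.neighborSet v).ncard}ᶜ with hL
  obtain ⟨S, hS, hchop⟩ := exists_isChopped (G.within L) (by exact_mod_cast hτ0 : 0 < τ) m
  have hdeg : ∀ v, ((G.within L).neighborSet v).ncard ≤ D := by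
    intro v
    by_cases hv : v ∈ L
    · exact (Set.ncard_le_ncard (fun u hu => hu.1 : _ ⊆ G.neighborSet v) (Set.toFinite _)).trans
        (not_lt.1 hv)
    · have : (G.within L).neighborSet v = ∅ := Set.eq_empty_of_forall_notMem fun u hu => hv hu.2.1
      simp [this]
  refine ⟨L ∩ S, ?_, fun v hv => ?_⟩
  · have h1 : ((L ∩ S)ᶜ.ncard : ℝ) ≤ Lᶜ.ncard + Sᶜ.ncard := by
      rw [Set.compl_inter]
      exact_mod_cast Set.ncard_union_le _ _
    have h2 : (Lᶜ.ncard : ℝ) * (D + 1) ≤ 2 * (d * Nat.card V) := by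
      rw [hL, compl_compl]
      exact_mod_cast (card_high_degree_mul_le G D).trans (Nat.mul_le_mul_left 2 hE)
    have h3 : (τ : ℝ) * Sᶜ.ncard ≤ m * Nat.card V := by exact_mod_cast hS
    have hn : (0 : ℝ) ≤ Nat.card V := by positivity
    rw [div_lt_iff₀ hε] at hτ hD
    have h4 : (Sᶜ.ncard : ℝ) ≤ ε / 2 * Nat.card V := by
      refine le_of_mul_le_mul_left (h3.trans ?_) hτ0
      nlinarith
    have h5 : (Lᶜ.ncard : ℝ) ≤ ε / 2 * Nat.card V := by
      refine le_of_mul_le_mul_right (h2.trans ?_) (by positivity : (0 : ℝ) < D + 1)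
      nlinarith [mul_nonneg hε.le hn]
    linarith
  · by_contra! hlt
    have hle : G.within (L ∩ S) ≤ (G.within L).within S :=
      fun _ _ h => ⟨⟨h.1, h.2.1.1, h.2.2.1⟩, h.2.1.2, h.2.2.2⟩
    obtain ⟨f, hf, hfar⟩ := exists_far_of_card (card_near_le hdeg _) m _
      (hlt.trans_le (Set.ncard_le_ncard (compWithin_mono hle v) (Set.toFinite _)))
    exact hG (((hchop v hv.2).isMinorOf H (by omega) (by omega) f hf hfar).mono (within_le L))

/-- A set without `t`-islands touches many edges. -/
lemma mul_card_le_card_edges_of_no_island [Finite V] (G : SimpleGraph V) (t : ℕ) (A : Finset V)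
    (hA : ∀ S : Set V, S ⊆ A → ¬ IsIsland G t S) :
    t * A.card ≤ {e ∈ G.edgeSet | ∃ v ∈ A, v ∈ e}.ncard := by
  classical
  induction hn : A.card generalizing A with
  | zero => simp
  | succ n ih =>
    have hne : A.Nonempty := Finset.card_pos.1 (by omega)
    have h1 : ∃ v ∈ A, t ≤ (G.neighborSet v \ A).ncard := by
      by_contra! h
      exact hA A subset_rfl ⟨hne, h⟩
    obtain ⟨v, hv, hvt⟩ := h1
    have h2 := ih (A.erase v)
      (fun S hS => hA S (hS.trans (by simp)))
      (by rw [Finset.card_erase_of_mem hv]; omega)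
    have hinj : Set.InjOn (fun u => s(v, u)) (G.neighborSet v \ A) := by
      intro a _ b _ hab
      exact Sym2.congr_right.1 hab
    have h3 : Disjoint {e ∈ G.edgeSet | ∃ w ∈ A.erase v, w ∈ e}
        ((fun u => s(v, u)) '' (G.neighborSet v \ A)) := by
      rw [Set.disjoint_left]
      rintro _ ⟨_, w, hw, hwe⟩ ⟨u, hu, rfl⟩
      rw [Finset.mem_erase] at hw
      rcases Sym2.mem_iff.1 hwe with rfl | rfl
      · exact hw.1 rfl
      · exact hu.2 hw.2
    calc t * (n + 1) = t * n + t := by ring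
      _ ≤ _ := Nat.add_le_add h2 (hvt.trans_eq hinj.ncard_image.symm)
      _ = _ := (Set.ncard_union_eq h3 (Set.toFinite _) (Set.toFinite _)).symm
      _ ≤ _ := by
        refine Set.ncard_le_ncard ?_ (Set.toFinite _)
        rintro e (⟨he, w, hw, hwe⟩ | ⟨u, hu, rfl⟩)
        · exact ⟨he, w, Finset.mem_of_mem_erase hw, hwe⟩
        · exact ⟨hu.1, v, hv, by simp⟩

/-- If the components after the removal of the complement of `S` have size at most `C` and few of
them contain islands, then `G` has many edges. -/
lemma mul_card_le_card_edges_add [Finite V] (G : SimpleGraph V) (t C : ℕ) (S : Set V)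
    (hC : ∀ v ∈ S, (G.compWithin S v).ncard ≤ C) :
    ∃ k, HasDisjointIslands G t k ∧ t * S.ncard ≤ G.edgeSet.ncard + t * (C * k) := by
  classical
  have := Fintype.ofFinite V
  set Γ := G.within S with hΓ
  set I : Finset Γ.ConnectedComponent :=
    S.toFinset.image Γ.connectedComponentMk with hI
  have hsupp : ∀ c ∈ I, ∃ v ∈ S, c.supp = G.compWithin S v := by
    intro c hc
    obtain ⟨v, hv, rfl⟩ := Finset.mem_image.1 hc
    refine ⟨v, by simpa using hv, ?_⟩
    ext u
    rw [ConnectedComponent.mem_supp_iff, ConnectedComponent.eq]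
    exact ⟨Reachable.symm, Reachable.symm⟩
  have hsuppS : ∀ c ∈ I, c.supp ⊆ S := by
    intro c hc
    obtain ⟨v, hv, h⟩ := hsupp c hc
    exact h ▸ compWithin_subset hv
  have hsuppC : ∀ c ∈ I, c.supp.toFinset.card ≤ C := by
    intro c hc
    obtain ⟨v, hv, h⟩ := hsupp c hc
    rw [← Set.ncard_eq_toFinset_card', h]
    exact hC v hv
  set J := I.filter fun c => ∃ T ⊆ c.supp, IsIsland G t T with hJ
  refine ⟨J.card, ?_, ?_⟩
  · have hT : ∀ c : J, ∃ T ⊆ c.1.supp, IsIsland G t T := fun c => (Finset.mem_filter.1 c.2).2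
    choose T hTs hTi using hT
    refine ⟨fun i => T (J.equivFin.symm i), fun i => hTi _, fun i j hij => ?_⟩
    refine Set.disjoint_of_subset (hTs _) (hTs _) ?_
    refine pairwise_disjoint_supp_connectedComponent Γ fun h => hij ?_
    exact J.equivFin.symm.injective (Subtype.ext h)
  · have hcover : S.ncard ≤ ∑ c ∈ I, c.supp.toFinset.card := by
      rw [Set.ncard_eq_toFinset_card']
      refine le_trans (Finset.card_le_card fun v hv => ?_) Finset.card_biUnion_le
      exact Finset.mem_biUnion.2 ⟨_, Finset.mem_image_of_mem _ hv, by simp⟩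
    have hsplit := Finset.sum_filter_add_sum_filter_not I
      (fun c => ∃ T ⊆ c.supp, IsIsland G t T) fun c => c.supp.toFinset.card
    have hJsum : ∑ c ∈ J, c.supp.toFinset.card ≤ C * J.card := by
      rw [Nat.mul_comm, ← smul_eq_mul]
      exact Finset.sum_le_card_nsmul _ _ _ fun c hc => hsuppC c (Finset.mem_filter.1 hc).1
    set J' := I.filter fun c => ¬ ∃ T ⊆ c.supp, IsIsland G t T with hJ'
    have hJ'sum : t * ∑ c ∈ J', c.supp.toFinset.card ≤ G.edgeSet.ncard := by
      set E : Γ.ConnectedComponent → Finset (Sym2 V) :=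
        fun c => {e ∈ G.edgeSet | ∃ v ∈ c.supp.toFinset, v ∈ e}.toFinset with hE
      have hdisj : (J' : Set Γ.ConnectedComponent).PairwiseDisjoint E := by
        intro c hc c' hc' hne
        refine Finset.disjoint_left.2 fun e he he' => hne ?_
        simp only [hE, Set.mem_toFinset] at he he'
        obtain ⟨heG, u, hu, hue⟩ := he
        obtain ⟨-, w, hw, hwe⟩ := he'
        have hu' := hsuppS c (Finset.mem_filter.1 hc).1 hu
        have hw' := hsuppS c' (Finset.mem_filter.1 hc').1 hw
        rw [ConnectedComponent.mem_supp_iff] at hu hw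
        rw [← hu, ← hw]
        by_cases huw : u = w
        · rw [huw]
        · rw [(Sym2.mem_and_mem_iff huw).1 ⟨hue, hwe⟩, mem_edgeSet] at heG
          exact ConnectedComponent.eq.2 (Adj.reachable ⟨heG, hu', hw'⟩)
      rw [Finset.mul_sum, Set.ncard_eq_toFinset_card']
      calc ∑ c ∈ J', t * c.supp.toFinset.card ≤ ∑ c ∈ J', (E c).card := by
            refine Finset.sum_le_sum fun c hc => ?_
            simp only [hE]
            rw [← Set.ncard_eq_toFinset_card' {e ∈ G.edgeSet | _}]
            refine mul_card_le_card_edges_of_no_island G t _ fun T hT hTi => ?_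
            exact (Finset.mem_filter.1 hc).2 ⟨T, by simpa using hT, hTi⟩
        _ = (J'.biUnion E).card := (Finset.card_biUnion hdisj).symm
        _ ≤ _ := Finset.card_le_card fun e he => by
            obtain ⟨c, -, hc⟩ := Finset.mem_biUnion.1 he
            simp only [hE, Set.mem_toFinset] at hc ⊢
            exact hc.1
    calc t * S.ncard ≤ t * (∑ c ∈ J, c.supp.toFinset.card + ∑ c ∈ J', c.supp.toFinset.card) :=
          Nat.mul_le_mul_left _ (hcover.trans_eq hsplit.symm)
      _ ≤ t * (C * J.card) + G.edgeSet.ncard := by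
          rw [Nat.mul_add]
          exact Nat.add_le_add (Nat.mul_le_mul_left _ hJsum) hJ'sum
      _ = _ := Nat.add_comm _ _

end SimpleGraph

/-- for every graph `H`, integer `t ≥ 1` and real `α > 0` there is `δ > 0`
such that every `H`-minor-free graph `G` with `|E(G)| ≤ (t-α)|V(G)|` contains at least
`δ|V(G)|` pairwise disjoint `t`-islands. -/
theorem stmt12 {W : Type} [Fintype W] (H : SimpleGraph W) (t : ℕ) (ht : 1 ≤ t)
    (α : ℝ) (hα : 0 < α) :
    ∃ δ : ℝ, 0 < δ ∧ ∀ (V : Type) (_ : Fintype V) (G : SimpleGraph V),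
      ¬ IsMinorOf H G → (G.edgeSet.ncard : ℝ) ≤ ((t : ℝ) - α) * (Nat.card V) →
      ∃ k : ℕ, δ * (Nat.card V) ≤ (k : ℝ) ∧ HasDisjointIslands G t k := by
  have ht0 : (0 : ℝ) < t := by exact_mod_cast ht
  obtain ⟨C, hC⟩ := exists_fragmentation H t (ε := α / (2 * t)) (by positivity)
  refine ⟨α / (2 * t * (C + 1)), by positivity, fun V _ G hG hE => ?_⟩
  have hn : (0 : ℝ) ≤ Nat.card V := by positivity
  have hE' : G.edgeSet.ncard ≤ t * Nat.card V := by
    have : (G.edgeSet.ncard : ℝ) ≤ t * Nat.card V := by nlinarith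
    exact_mod_cast this
  obtain ⟨S, hS, hcomp⟩ := hC V G hG hE'
  obtain ⟨k, hk, hcount⟩ := mul_card_le_card_edges_add G t C S hcomp
  refine ⟨k, ?_, hk⟩
  have h1 : (t : ℝ) * S.ncard ≤ G.edgeSet.ncard + t * (C * k) := by exact_mod_cast hcount
  have h2 : (S.ncard : ℝ) + Sᶜ.ncard = Nat.card V := by
    exact_mod_cast Set.ncard_add_ncard_compl S
  have h3 : (t : ℝ) * Sᶜ.ncard ≤ α / 2 * Nat.card V := by
    calc (t : ℝ) * Sᶜ.ncard ≤ t * (α / (2 * t) * Nat.card V) := by gcongr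
      _ = α / 2 * Nat.card V := by field_simp
  have h4 : (t : ℝ) * S.ncard = t * Nat.card V - t * Sᶜ.ncard := by rw [← h2]; ring
  have h5 : (0 : ℝ) ≤ t * k := by positivity
  rw [div_mul_eq_mul_div, div_le_iff₀ (by positivity)]
  nlinarith
end
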